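/- arXiv:1102.0142 — 6 statements merged into one kernel-verified Lean document; each statement's English description precedes it below -/
import Mathlib

section
/- For every fixed s > 1, the function Q ↦ Q/(s^Q − 1) + Q/(s^{Q+1} + 1) is decreasing on (0, +∞). -/
open MeasureTheory Filter Set
open scoped Topology ENNReal NNReal Classical

/-- The metric on `Σ = {0,1}^ℕ` in which two sequences are at distance `2^{-n}`,
`n` being the first index where they differ. -/
noncomputable instance : MetricSpace (ℕ → Bool) := PiNat.metricSpace

/-- The cylinder of generation `n` containing `x`. -/
def cyl (x : ℕ → Bool) (n : ℕ) : Set (ℕ → Bool) := {y | ∀ i < n, y i = x i}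

/-- `τ(p,q) = log₂(p^q + (1-p)^q)`, the `L^q`-spectrum of the homogeneous Bernoulli
product of parameter `p`. -/
noncomputable def tauP (p q : ℝ) : ℝ := Real.logb 2 (p ^ q + (1 - p) ^ q)

/-- `τ_n(q) = (1/n) ∑_{k<n} log₂(p_k^q + (1-p_k)^q)`. -/
noncomputable def tauN (p : ℕ → ℝ) (n : ℕ) (q : ℝ) : ℝ :=
  (1 / n) * ∑ k ∈ Finset.range n, tauP (p k) q

/-- The `L^q`-spectrum `τ(q) = limsup_n τ_n(q)`. -/
noncomputable def tauLq (p : ℕ → ℝ) (q : ℝ) : ℝ :=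
  Filter.limsup (fun n => tauN p n q) Filter.atTop

/-- `μ` is the inhomogeneous Bernoulli product with weights `p`:
`μ(I_{ε_1…ε_n}) = ∏_{j=1}^n p_j^{1-ε_j} (1-p_j)^{ε_j}`. -/
def IsBernoulli (μ : Measure (ℕ → Bool)) (p : ℕ → ℝ) : Prop :=
  ∀ (n : ℕ) (ε : ℕ → Bool),
    μ (cyl ε n) = ENNReal.ofReal (∏ j ∈ Finset.range n, if ε j then 1 - p j else p j)

/-- `α_n(x) = -log μ(I_n(x)) / (n log 2)`. -/
noncomputable def alphaN (μ : Measure (ℕ → Bool)) (x : ℕ → Bool) (n : ℕ) : ℝ :=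
  -Real.log (μ (cyl x n)).toReal / (n * Real.log 2)

/-- The local dimension `α(x) = liminf_n α_n(x)`. -/
noncomputable def alphaDim (μ : Measure (ℕ → Bool)) (x : ℕ → Bool) : ℝ :=
  Filter.liminf (fun n => alphaN μ x n) Filter.atTop

/-- The Legendre transform `τ*(α) = inf_{q ∈ ℝ} (α q + τ(q))`. -/
noncomputable def tauStar (p : ℕ → ℝ) (α : ℝ) : ℝ := ⨅ q : ℝ, (α * q + tauLq p q)

/-- `τ` is finite (i.e. the defining `limsup` is a genuine finite limsup) on a
neighborhood of `q`. -/
def TauFiniteNear (p : ℕ → ℝ) (q : ℝ) : Prop :=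
  ∃ δ > (0:ℝ), ∀ q' ∈ Set.Ioo (q - δ) (q + δ),
    BddAbove (Set.range fun n => tauN p n q') ∧ BddBelow (Set.range fun n => tauN p n q')

theorem aux14_c1 (x y : ℝ) (hy : 1 < y) (hx : x = Real.log y) :
    (y - 1 - x * y) / (y - 1) ^ 2 + (y + 1 - x * y) / (y + 1) ^ 2 ≤ 0 := by
  have h := Real.le_log_one_add_of_nonneg (x := y ^ 2 - 1) (by nlinarith)
  have e : Real.log (1 + (y ^ 2 - 1)) = 2 * x := by
    rw [hx, show 1 + (y ^ 2 - 1) = y ^ 2 by ring, Real.log_pow]; norm_num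
  rw [e, div_le_iff₀ (by nlinarith)] at h
  have h1 : 0 < y - 1 := by linarith
  have h2 : 0 < y + 1 := by linarith
  rw [div_add_div _ _ (by positivity) (by positivity)]
  apply div_nonpos_of_nonpos_of_nonneg _ (by positivity)
  have h3 : (y ^ 2 - 1) - x * (y ^ 2 + 1) ≤ 0 := by linarith
  have : (y - 1 - x * y) * (y + 1) ^ 2 + (y - 1) ^ 2 * (y + 1 - x * y)
    = 2 * y * ((y ^ 2 - 1) - x * (y ^ 2 + 1)) := by ring
  rw [this]
  exact mul_nonpos_of_nonneg_of_nonpos (by linarith) h3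

theorem aux14 (x y z : ℝ) (hy : 1 < y) (hz : y ≤ z) (hx : x = Real.log y) :
    (y - 1 - x * y) / (y - 1) ^ 2 + (z + 1 - x * z) / (z + 1) ^ 2 ≤ 0 := by
  have hx0 : 0 < x := hx ▸ Real.log_pos hy
  have hA : (y - 1 - x * y) / (y - 1) ^ 2 ≤ 0 := by
    apply div_nonpos_of_nonpos_of_nonneg _ (by positivity)
    have := Real.one_sub_inv_le_log_of_pos (x := y) (by linarith)
    rw [← hx] at this
    have h2 := mul_le_mul_of_nonneg_right this (by linarith : (0:ℝ) ≤ y)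
    rw [sub_mul, inv_mul_cancel₀ (by linarith)] at h2
    linarith
  rcases le_or_gt (z + 1 - x * z) 0 with h | h
  · have : (z + 1 - x * z) / (z + 1) ^ 2 ≤ 0 :=
      div_nonpos_of_nonpos_of_nonneg h (by positivity)
    linarith
  · have key : ∀ w : ℝ, 1 < w → (w + 1 - x * w) / (w + 1) ^ 2
        = (w + 1)⁻¹ * (1 - x + x * (w + 1)⁻¹) := by
      intro w hw
      have : w + 1 ≠ 0 := by linarith
      field_simp
      ring
    have hz1 : 1 < z := by linarith
    have hpos : 0 < 1 - x + x * (z + 1)⁻¹ := by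
      have : 1 - x + x * (z + 1)⁻¹ = (z + 1 - x * z) / (z + 1) := by
        have : z + 1 ≠ 0 := by linarith
        field_simp
        ring
      rw [this]
      exact div_pos h (by linarith)
    have hu : (z + 1)⁻¹ ≤ (y + 1)⁻¹ := inv_anti₀ (by linarith) (by linarith)
    have hle : (z + 1 - x * z) / (z + 1) ^ 2 ≤ (y + 1 - x * y) / (y + 1) ^ 2 := by
      rw [key z hz1, key y hy]
      apply mul_le_mul hu _ hpos.le (by positivity)
      have := mul_le_mul_of_nonneg_left hu hx0.le
      linarith
    have := aux14_c1 x y hy hx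
    linarith

/-- For every fixed `s > 1`, the function `Q ↦ Q/(s^Q - 1) + Q/(s^{Q+1} + 1)` is
decreasing on `(0, ∞)`. -/
theorem stmt14 (s : ℝ) (hs : 1 < s) :
    AntitoneOn (fun Q : ℝ => Q / (s ^ Q - 1) + Q / (s ^ (Q + 1) + 1))
      (Set.Ioi (0:ℝ)) := by
  have hs0 : 0 < s := by linarith
  have hy : ∀ Q : ℝ, 0 < Q → 1 < s ^ Q := fun Q hQ => Real.one_lt_rpow hs hQ
  have hd : ∀ Q : ℝ, 0 < Q → HasDerivAt
      (fun Q : ℝ => Q / (s ^ Q - 1) + Q / (s ^ (Q + 1) + 1))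
      ((1 * (s ^ Q - 1) - Q * (Real.log s * 1 * s ^ Q)) / (s ^ Q - 1) ^ 2 +
       (1 * (s ^ (Q + 1) + 1) - Q * (Real.log s * 1 * s ^ (Q + 1))) / (s ^ (Q + 1) + 1) ^ 2) Q := by
    intro Q hQ
    have h1 := hy Q hQ
    have h2 := hy (Q + 1) (by linarith)
    have a := ((hasDerivAt_id Q).const_rpow hs0).sub_const 1
    have b := (((hasDerivAt_id Q).add_const 1).const_rpow hs0).add_const 1
    exact ((hasDerivAt_id Q).div a (sub_pos.2 h1).ne').add
      ((hasDerivAt_id Q).div b (by positivity))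
  apply antitoneOn_of_deriv_nonpos (convex_Ioi 0)
  · exact fun Q hQ => (hd Q hQ).continuousAt.continuousWithinAt
  · rw [interior_Ioi]
    exact fun Q hQ => (hd Q hQ).differentiableAt.differentiableWithinAt
  · rw [interior_Ioi]
    intro Q hQ
    rw [(hd Q hQ).deriv]
    have := aux14 (Q * Real.log s) (s ^ Q) (s ^ (Q + 1)) (hy Q hQ)
      (Real.rpow_le_rpow_of_exponent_le hs.le (by linarith)) (Real.log_rpow hs0 Q).symm
    convert this using 3 <;> ring
end

section
/- Let 0 < p₁ < p₂ < 1/2, λ ∈ (0,1), and set τ(q) = λ·τ(p₁,q) + (1−λ)·τ(p₂,q). Then for any p₀ ∈ (0,1/2), exactly one of the following occurs: (1) τ(q) ≠ τ(p₀,q) for all q > 1; or (2) there exists a unique q₀ > 1 with τ(q₀) = τ(p₀,q₀), and in that case τ(q) > τ(p₀,q) for 1 < q < q₀ and τ(q) < τ(p₀,q) for q > q₀. -/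
open MeasureTheory Filter Set
open scoped Topology ENNReal NNReal Classical

noncomputable def ff (q s : ℝ) : ℝ := Real.log (2 * Real.cosh (q * s)) - q * Real.log (2 * Real.cosh s)

noncomputable def ff' (q s : ℝ) : ℝ := q * Real.sinh ((q - 1) * s) / (Real.cosh (q * s) * Real.cosh s)

lemma ff_deriv (q s : ℝ) : HasDerivAt (ff q) (ff' q s) s := by
  have c1 := Real.cosh_pos (q * s)
  have c2 := Real.cosh_pos s
  have h1 : HasDerivAt (fun s => 2 * Real.cosh (q * s)) (2 * (Real.sinh (q * s) * (q * 1))) s :=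
    (((hasDerivAt_id s).const_mul q).cosh).const_mul 2
  have h2 : HasDerivAt (fun s => 2 * Real.cosh s) (2 * Real.sinh s) s :=
    (Real.hasDerivAt_cosh s).const_mul 2
  have h := (h1.log (by positivity)).sub ((h2.log (by positivity)).const_mul q)
  have e : ff' q s = 2 * (Real.sinh (q * s) * (q * 1)) / (2 * Real.cosh (q * s)) -
      q * (2 * Real.sinh s / (2 * Real.cosh s)) := by
    unfold ff'
    rw [show (q - 1) * s = q * s - s by ring, Real.sinh_sub]
    field_simp
  rw [e]
  exact h

lemma ff'_pos {q s : ℝ} (hq : 1 < q) (hs : 0 < s) : 0 < ff' q s := by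
  have c1 := Real.cosh_pos (q * s)
  have c2 := Real.cosh_pos s
  have : 0 < Real.sinh ((q - 1) * s) := Real.sinh_pos_iff.2 (mul_pos (by linarith) hs)
  unfold ff'
  positivity

lemma cauchy {F G F' G' : ℝ → ℝ} {x y z : ℝ} (hxy : x < y) (hyz : y < z)
    (hF : ∀ t, HasDerivAt F (F' t) t) (hG : ∀ t, HasDerivAt G (G' t) t)
    (pos : ∀ t, x < t → t < z → 0 < G' t)
    (h : ∀ u v, x < u → u < y → y < v → v < z → F' v * G' u < F' u * G' v) :
    (F z - F y) * (G y - G x) < (F y - F x) * (G z - G y) := by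
  have cF : Continuous F := continuous_iff_continuousAt.2 fun t => (hF t).continuousAt
  have cG : Continuous G := continuous_iff_continuousAt.2 fun t => (hG t).continuousAt
  obtain ⟨u, hu, eu⟩ := exists_ratio_hasDerivAt_eq_ratio_slope F F' hxy cF.continuousOn
    (fun t _ => hF t) G G' cG.continuousOn (fun t _ => hG t)
  obtain ⟨v, hv, ev⟩ := exists_ratio_hasDerivAt_eq_ratio_slope F F' hyz cF.continuousOn
    (fun t _ => hF t) G G' cG.continuousOn (fun t _ => hG t)
  obtain ⟨u1, hu1, eu1⟩ := exists_hasDerivAt_eq_slope G G' hxy cG.continuousOn (fun t _ => hG t)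
  obtain ⟨v1, hv1, ev1⟩ := exists_hasDerivAt_eq_slope G G' hyz cG.continuousOn (fun t _ => hG t)
  have pu := pos u hu.1 (hu.2.trans hyz)
  have pv := pos v (hxy.trans hv.1) hv.2
  have A : 0 < G y - G x := by
    have := pos u1 hu1.1 (hu1.2.trans hyz)
    rw [eu1] at this
    exact (div_pos_iff_of_pos_right (by linarith)).1 this
  have B : 0 < G z - G y := by
    have := pos v1 (hxy.trans hv1.1) hv1.2
    rw [ev1] at this
    exact (div_pos_iff_of_pos_right (by linarith)).1 this
  have k := h u v hu.1 hu.2 hv.1 hv.2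
  have k2 := mul_lt_mul_of_pos_left k (mul_pos A B)
  have : (G' u * G' v) * ((F z - F y) * (G y - G x)) <
      (G' u * G' v) * ((F y - F x) * (G z - G y)) := by
    calc _ = (F z - F y) * G' v * (G' u * (G y - G x)) := by ring
      _ = (G y - G x) * (G z - G y) * (F' v * G' u) := by rw [← ev]; ring
      _ < _ := k2
      _ = (G y - G x) * F' u * (G' v * (G z - G y)) := by ring
      _ = _ := by rw [eu]; ring
  exact lt_of_mul_lt_mul_left this (mul_pos pu pv).le

lemma cosh_ineq {u v s t : ℝ} (h1 : -v < u) (h2 : u < v) (hs : 0 < s) (hst : s < t) :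
    Real.cosh (s * v) * Real.cosh (t * u) < Real.cosh (s * u) * Real.cosh (t * v) := by
  wlog hu : 0 ≤ u generalizing u
  · have := this (u := -u) (by linarith) (by linarith) (by linarith)
    simpa only [mul_neg, Real.cosh_neg] using this
  have e1 : Real.cosh (t * u + s * v) < Real.cosh (t * v + s * u) := by
    rw [Real.cosh_lt_cosh, abs_lt]
    have : 0 < t * v + s * u := by have : 0 < v := by linarith
                                   have : 0 < t := by linarith
                                   positivity
    rw [abs_of_pos this]
    constructor
    · have : 0 ≤ t * u := mul_nonneg (by linarith) hu
      have : 0 < s * v := mul_pos hs (by linarith)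
      linarith
    · nlinarith [mul_pos (sub_pos.2 h2) (sub_pos.2 hst)]
  have e2 : Real.cosh (t * u - s * v) < Real.cosh (t * v - s * u) := by
    rw [Real.cosh_lt_cosh, abs_lt]
    have : 0 < t * v - s * u := by
      nlinarith [mul_pos (sub_pos.2 h2) hs, mul_pos (show 0 < v by linarith) (sub_pos.2 hst)]
    rw [abs_of_pos this]
    constructor
    · nlinarith [mul_pos (show 0 < v + u by linarith) (sub_pos.2 hst)]
    · nlinarith [mul_pos (sub_pos.2 h2) (show 0 < s + t by linarith)]
  rw [Real.cosh_add, Real.cosh_add] at e1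
  rw [Real.cosh_sub, Real.cosh_sub] at e2
  linarith

lemma sinh_ineq {a b m s t : ℝ} (ha : -b < a) (hab : a < b) (hbm : b < m) (hs : 0 < s)
    (hst : s < t) :
    (Real.sinh (s * m) - Real.sinh (s * b)) * (Real.sinh (t * b) - Real.sinh (t * a)) <
    (Real.sinh (s * b) - Real.sinh (s * a)) * (Real.sinh (t * m) - Real.sinh (t * b)) := by
  have ht : 0 < t := hs.trans hst
  have hd : ∀ s x : ℝ, HasDerivAt (fun x => Real.sinh (s * x)) (Real.cosh (s * x) * (s * 1)) x :=
    fun s x => ((hasDerivAt_id x).const_mul s).sinh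
  refine cauchy hab hbm (hd s) (hd t) (fun x _ _ => ?_) (fun u v h1 h2 h3 h4 => ?_)
  · have := Real.cosh_pos (t * x)
    positivity
  · have := mul_lt_mul_of_pos_left (cosh_ineq (u := u) (v := v) (by linarith) (by linarith) hs hst)
      (mul_pos hs ht)
    linarith

lemma ND {q r s t : ℝ} (hq : 1 < q) (hr : q < r) (hs : 0 < s) (hst : s < t) :
    (Real.sinh ((r - 1) * t) * Real.cosh (q * t)) * (Real.sinh ((q - 1) * s) * Real.cosh (r * s)) <
    (Real.sinh ((r - 1) * s) * Real.cosh (q * s)) * (Real.sinh ((q - 1) * t) * Real.cosh (r * t)) := by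
  have key := sinh_ineq (a := 1 - (r - q)) (b := 1 + (r - q)) (m := q + r - 1) (s := s) (t := t)
    (by linarith) (by linarith) (by linarith) hs hst
  have hD : ∀ s, Real.sinh (s * (q + r - 1)) - Real.sinh (s * (1 + (r - q))) =
      2 * (Real.sinh ((q - 1) * s) * Real.cosh (r * s)) := by
    intro s
    rw [show s * (q + r - 1) = (q - 1) * s + r * s by ring,
      show s * (1 + (r - q)) = r * s - (q - 1) * s by ring, Real.sinh_add, Real.sinh_sub]
    ring
  have hN : ∀ s, Real.sinh (s * (q + r - 1)) - Real.sinh (s * (1 - (r - q))) =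
      2 * (Real.sinh ((r - 1) * s) * Real.cosh (q * s)) := by
    intro s
    rw [show s * (q + r - 1) = (r - 1) * s + q * s by ring,
      show s * (1 - (r - q)) = q * s - (r - 1) * s by ring, Real.sinh_add, Real.sinh_sub]
    ring
  have d1 := hD s
  have d2 := hD t
  have n1 := hN s
  have n2 := hN t
  have E1 : Real.sinh (s * (1 + (r - q))) - Real.sinh (s * (1 - (r - q))) =
    2 * (Real.sinh ((r - 1) * s) * Real.cosh (q * s)) -
    2 * (Real.sinh ((q - 1) * s) * Real.cosh (r * s)) := by linarith
  have E2 : Real.sinh (t * (1 + (r - q))) - Real.sinh (t * (1 - (r - q))) =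
    2 * (Real.sinh ((r - 1) * t) * Real.cosh (q * t)) -
    2 * (Real.sinh ((q - 1) * t) * Real.cosh (r * t)) := by linarith
  rw [d1, d2, E1, E2] at key
  linarith

lemma ff_ineq {q r x y z : ℝ} (hq : 1 < q) (hr : q < r) (hx : 0 < x) (hxy : x < y) (hyz : y < z) :
    (ff r z - ff r y) * (ff q y - ff q x) < (ff r y - ff r x) * (ff q z - ff q y) := by
  refine cauchy hxy hyz (ff_deriv r) (ff_deriv q) (fun t h _ => ff'_pos hq (hx.trans h))
    (fun u v h1 h2 h3 h4 => ?_)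
  have key := ND hq hr (hx.trans h1) (h2.trans h3)
  have c1 := Real.cosh_pos (q * u)
  have c2 := Real.cosh_pos (q * v)
  have c3 := Real.cosh_pos (r * u)
  have c4 := Real.cosh_pos (r * v)
  have c5 := Real.cosh_pos u
  have c6 := Real.cosh_pos v
  have c7 : 0 < q := by linarith
  have c8 : 0 < r := by linarith
  unfold ff'
  rw [div_mul_div_comm, div_mul_div_comm, div_lt_div_iff₀ (by positivity) (by positivity)]
  have := mul_lt_mul_of_pos_left key (show 0 < q * r * (Real.cosh (q * u) * Real.cosh (q * v) *
    Real.cosh (r * u) * Real.cosh (r * v) * Real.cosh u * Real.cosh v) *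
    1 by positivity)
  have P : 0 < q * r * Real.cosh u * Real.cosh v := by positivity
  have := mul_lt_mul_of_pos_left key P
  linarith

lemma ff_mono {q : ℝ} (hq : 1 < q) : StrictMonoOn (ff q) (Set.Ioi 0) := by
  refine strictMonoOn_of_deriv_pos (convex_Ioi 0)
    (fun t _ => (ff_deriv q t).continuousAt.continuousWithinAt) (fun t ht => ?_)
  rw [interior_Ioi] at ht
  rw [(ff_deriv q t).deriv]
  exact ff'_pos hq ht

noncomputable def SS (p : ℝ) : ℝ := Real.log ((1 - p) / p) / 2

lemma SS_lt {a b : ℝ} (ha : 0 < a) (hab : a < b) (hb : b < 1) : SS b < SS a := by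
  unfold SS
  have : (1 - b) / b < (1 - a) / a := by
    rw [div_lt_div_iff₀ (by linarith) ha]
    nlinarith
  have := Real.log_lt_log (div_pos (by linarith) (by linarith)) this
  linarith

lemma SS_pos {a : ℝ} (ha : 0 < a) (hb : a < 1 / 2) : 0 < SS a := by
  unfold SS
  have : 1 < (1 - a) / a := by
    rw [lt_div_iff₀ ha]; linarith
  have := Real.log_pos this
  linarith

lemma tauP_eq {p : ℝ} (hp : 0 < p) (hp2 : p < 1 / 2) (q : ℝ) :
    tauP p q = ff q (SS p) / Real.log 2 := by
  have c1 := Real.cosh_pos (q * SS p)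
  have c2 := Real.cosh_pos (SS p)
  have h1p : 0 < 1 - p := by linarith
  set s := SS p with hs
  have hlog : Real.log (1 - p) - Real.log p = 2 * s := by
    rw [hs, SS, Real.log_div h1p.ne' hp.ne']; ring
  set m := (Real.log (1 - p) + Real.log p) / 2 with hm
  have e1 : Real.log (1 - p) = m + s := by linarith
  have e2 : Real.log p = m - s := by linarith
  have a1 : 1 - p = Real.exp m * Real.exp s := by rw [← Real.exp_add, ← e1, Real.exp_log h1p]
  have a2 : p = Real.exp m * Real.exp (-s) := by
    rw [← Real.exp_add, ← sub_eq_add_neg, ← e2, Real.exp_log hp]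
  have a3 : Real.exp m * (2 * Real.cosh s) = 1 := by
    rw [Real.cosh_eq]; linarith
  have a4 : m + Real.log (2 * Real.cosh s) = 0 := by
    have := congrArg Real.log a3
    rwa [Real.log_mul (Real.exp_pos m).ne' (by positivity), Real.log_exp, Real.log_one] at this
  have a5 : p ^ q + (1 - p) ^ q = Real.exp (m * q) * (2 * Real.cosh (q * s)) := by
    rw [Real.rpow_def_of_pos hp, Real.rpow_def_of_pos h1p, e1, e2, Real.cosh_eq,
      show (m - s) * q = m * q + -(q * s) by ring, show (m + s) * q = m * q + q * s by ring,
      Real.exp_add, Real.exp_add]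
    ring
  unfold tauP Real.logb ff
  rw [a5, Real.log_mul (Real.exp_pos _).ne' (by positivity), Real.log_exp]
  congr 1
  linear_combination q * a4

/-- **Lemma 4.2.** For `τ = λ τ(p₁,·) + (1-λ) τ(p₂,·)` with `0 < p₁ < p₂ < 1/2`,
`λ ∈ (0,1)`, and any `p₀ ∈ (0,1/2)`: either `τ(q) ≠ τ(p₀,q)` for all `q > 1`, or there
is a unique `q₀ > 1` with `τ(q₀) = τ(p₀,q₀)`, and then `τ > τ(p₀,·)` on `(1,q₀)` and
`τ < τ(p₀,·)` on `(q₀,∞)`. -/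
theorem stmt15 (p₁ p₂ : ℝ) (h₁ : 0 < p₁) (h₁₂ : p₁ < p₂) (h₂ : p₂ < 1 / 2)
    (lam : ℝ) (hlam : lam ∈ Set.Ioo (0:ℝ) 1)
    (p₀ : ℝ) (hp₀ : p₀ ∈ Set.Ioo (0:ℝ) (1 / 2)) :
    (∀ q : ℝ, 1 < q → lam * tauP p₁ q + (1 - lam) * tauP p₂ q ≠ tauP p₀ q) ∨
    (∃ q₀ : ℝ, 1 < q₀ ∧
      lam * tauP p₁ q₀ + (1 - lam) * tauP p₂ q₀ = tauP p₀ q₀ ∧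
      (∀ q : ℝ, 1 < q → q < q₀ →
        tauP p₀ q < lam * tauP p₁ q + (1 - lam) * tauP p₂ q) ∧
      (∀ q : ℝ, q₀ < q →
        lam * tauP p₁ q + (1 - lam) * tauP p₂ q < tauP p₀ q) ∧
      (∀ q : ℝ, 1 < q → lam * tauP p₁ q + (1 - lam) * tauP p₂ q = tauP p₀ q →
        q = q₀)) := by
  have hl1 := hlam.1
  have hl2 := hlam.2
  have h10 : p₁ < 1 / 2 := h₁₂.trans h₂
  have h20 : 0 < p₂ := h₁.trans h₁₂
  have L : 0 < Real.log 2 := Real.log_pos (by norm_num)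
  have t1 := tauP_eq h₁ h10
  have t2 := tauP_eq h20 h₂
  have t0 := tauP_eq hp₀.1 hp₀.2
  have s1 := SS_pos h₁ h10
  have s2 := SS_pos h20 h₂
  have s0 := SS_pos hp₀.1 hp₀.2
  have s21 : SS p₂ < SS p₁ := SS_lt h₁ h₁₂ (by linarith)
  generalize SS p₁ = x1 at *
  generalize SS p₂ = x2 at *
  generalize SS p₀ = x0 at *
  have hc : ∀ q, lam * tauP p₁ q + (1 - lam) * tauP p₂ q - tauP p₀ q =
      (lam * (ff q x1 - ff q x0) - (1 - lam) * (ff q x0 - ff q x2)) / Real.log 2 := by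
    intro q
    rw [t1, t2, t0]
    field_simp
    ring
  by_cases H : ∀ q : ℝ, 1 < q → lam * tauP p₁ q + (1 - lam) * tauP p₂ q ≠ tauP p₀ q
  · exact Or.inl H
  right
  push Not at H
  obtain ⟨q₀, hq₀, e⟩ := H
  have e0 : lam * (ff q₀ x1 - ff q₀ x0) - (1 - lam) * (ff q₀ x0 - ff q₀ x2) = 0 := by
    have := hc q₀
    rw [e, sub_self, eq_comm, div_eq_zero_iff] at this
    exact this.resolve_right L.ne'
  have m21 := ff_mono hq₀ s2 s1 s21
  have x20 : x2 < x0 := by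
    by_contra! hle
    have := (ff_mono hq₀).monotoneOn s0 s2 hle
    nlinarith
  have x01 : x0 < x1 := by
    by_contra! hle
    have := (ff_mono hq₀).monotoneOn s1 s0 hle
    nlinarith
  have key : ∀ q r, 1 < q → q < r →
      lam * tauP p₁ q + (1 - lam) * tauP p₂ q ≤ tauP p₀ q →
      lam * tauP p₁ r + (1 - lam) * tauP p₂ r < tauP p₀ r := by
    intro q r hq hr hle
    have k := ff_ineq hq hr s2 x20 x01
    have g1 : lam * (ff q x1 - ff q x0) - (1 - lam) * (ff q x0 - ff q x2) ≤ 0 := by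
      have h := hc q
      rw [eq_div_iff L.ne'] at h
      rw [← h]
      exact mul_nonpos_of_nonpos_of_nonneg (by linarith) L.le
    have A := ff_mono hq s2 s0 x20
    have B := ff_mono hq s0 s1 x01
    have C := ff_mono (hq.trans hr) s2 s0 x20
    have D := ff_mono (hq.trans hr) s0 s1 x01
    have g2 : lam * (ff r x1 - ff r x0) - (1 - lam) * (ff r x0 - ff r x2) < 0 := by
      have i1 := mul_lt_mul_of_pos_left k hl1
      have i2 := mul_le_mul_of_nonneg_left g1 (sub_pos.2 C).le
      have : (ff q x0 - ff q x2) *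
        (lam * (ff r x1 - ff r x0) - (1 - lam) * (ff r x0 - ff r x2)) < 0 := by linarith
      exact (pos_iff_neg_of_mul_neg this).1 (sub_pos.2 A)
    have h := hc r
    have := div_neg_of_neg_of_pos g2 L
    linarith
  have lo : ∀ q : ℝ, 1 < q → q < q₀ →
        tauP p₀ q < lam * tauP p₁ q + (1 - lam) * tauP p₂ q := by
    intro q hq hqq
    by_contra! hle
    exact (key q q₀ hq hqq hle).ne e
  have hi : ∀ q : ℝ, q₀ < q →
        lam * tauP p₁ q + (1 - lam) * tauP p₂ q < tauP p₀ q :=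
    fun q hq => key q₀ q hq₀ hq e.le
  refine ⟨q₀, hq₀, e, lo, hi, fun q hq he => ?_⟩
  rcases lt_trichotomy q q₀ with h | h | h
  · exact absurd he (lo q hq h).ne'
  · exact h
  · exact absurd he (hi q h).ne
end

section
/- Let λ₁, λ₂ ∈ (0,1) with λ₁ + λ₂ = 1, let 0 < p₁ < p₂ < 1/2, and set τ = λ₁·τ(p₁,·) + λ₂·τ(p₂,·). Fix 1 < q₁ < q₂ < +∞ and let p₁ < p₄ < p₂ < p₅ < 1/2 be such that τ(p₄,q₁) = τ(q₁). Then there exists a unique triple (λ₃, λ₄, λ₅) of strictly positive reals with λ₃ + λ₄ + λ₅ = 1 such that the convex combination τ̃ = λ₃·τ(p₁,·) + λ₄·τ(p₄,·) + λ₅·τ(p₅,·) satisfies τ̃(q₁) = τ(q₁) and τ̃(q₂) = τ(q₂). Furthermore, τ̃'(q_i) ≠ τ'(q_i) for i = 1,2, and τ̃(q) ≠ τ(q) for every q ∈ (1,∞) with q ∉ {q₁, q₂}. -/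
open MeasureTheory Filter Set
open scoped Topology ENNReal NNReal Classical

namespace S16
open Real

noncomputable def th (x : ℝ) : ℝ := sinh x / (1 + cosh x)
noncomputable def kk (x : ℝ) : ℝ := 1 / (1 + cosh x)
noncomputable def T (x : ℝ) : ℝ := x * sinh x / (1 + cosh x)
noncomputable def T1 (x : ℝ) : ℝ := (sinh x + x) / (1 + cosh x)
noncomputable def Z (x : ℝ) : ℝ := x * (1 + cosh x) / (sinh x + x) - 3 * T x

lemma cpos (x : ℝ) : 0 < 1 + cosh x := by have := cosh_pos x; linarith

lemma csq (x : ℝ) : cosh x ^ 2 = 1 + sinh x ^ 2 := by rw [cosh_sq]; ring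

lemma kk_pos (x : ℝ) : 0 < kk x := by unfold kk; have := cpos x; positivity

lemma hT (x : ℝ) : HasDerivAt T (T1 x) x := by
  have h := ((hasDerivAt_id x).mul (hasDerivAt_sinh x)).div ((hasDerivAt_cosh x).const_add 1)
    (cpos x).ne'
  refine h.congr_deriv ?_
  have := cpos x
  unfold T1
  simp only [id, Pi.mul_apply]
  field_simp
  linear_combination x * csq x

lemma hkk (x : ℝ) : HasDerivAt kk (-(th x * kk x)) x := by
  have h := (hasDerivAt_const x (1:ℝ)).div ((hasDerivAt_cosh x).const_add 1) (cpos x).ne'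
  refine h.congr_deriv ?_
  have := cpos x
  unfold th kk
  field_simp
  ring

lemma T1_pos {x : ℝ} (hx : 0 < x) : 0 < T1 x := by
  have := cpos x
  have := sinh_pos_iff.2 hx
  unfold T1; positivity

lemma T_mono {a b : ℝ} (ha : 0 < a) (hab : a < b) : T a < T b := by
  have : StrictMonoOn T (Ioi 0) := by
    apply strictMonoOn_of_deriv_pos (convex_Ioi 0)
    · exact fun x _ => (hT x).continuousAt.continuousWithinAt
    · intro x hx
      rw [interior_Ioi] at hx
      rw [(hT x).deriv]; exact T1_pos hx
  exact this ha (ha.trans hab) hab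

lemma xT1 (x : ℝ) : x * T1 x = T x + (x ^ 2 - T x ^ 2) / 2 := by
  have := cpos x
  unfold T1 T
  field_simp
  linear_combination (-x ^ 2) * csq x

lemma key {x : ℝ} (hx : 0 < x) :
    (sinh x - x) * (1 + cosh x) ^ 2 + x ^ 2 * sinh x * (1 + cosh x) < 3 * (sinh x + x) ^ 3 := by
  have hS := sinh_pos_iff.2 hx
  have hSx : x < sinh x := self_lt_sinh_iff.2 hx
  have hC := one_lt_cosh.2 hx.ne'
  have h1 : sinh x ≤ x * cosh x := by
    have hm : MonotoneOn (fun x => x * cosh x - sinh x) (Ici 0) := by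
      apply monotoneOn_of_deriv_nonneg (convex_Ici 0)
      · fun_prop
      · fun_prop
      · intro y hy
        rw [interior_Ici] at hy
        have h := ((hasDerivAt_id y).mul (hasDerivAt_cosh y)).sub (hasDerivAt_sinh y)
        have h2 : deriv (fun x => x * cosh x - sinh x) y = _ := h.deriv
        rw [h2]
        have := sinh_pos_iff.2 hy
        have hy' : 0 < y := hy
        simp only [id]
        nlinarith [mul_pos hy' this]
    have := hm (show (0:ℝ) ∈ Ici 0 by simp) (show x ∈ Ici 0 from hx.le) hx.le
    simp at this
    linarith
  have h2 : x ^ 2 ≤ 2 * (cosh x - 1) := by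
    have e : cosh x = 1 + 2 * sinh (x/2) ^ 2 := by
      have := cosh_two_mul (x/2)
      rw [show 2 * (x/2) = x by ring, csq] at this
      linarith
    have : x/2 < sinh (x/2) := self_lt_sinh_iff.2 (by linarith)
    nlinarith
  have h3 : cosh x ≤ 1 + sinh x := by
    have := cosh_sub_sinh x
    have : rexp (-x) ≤ 1 := by rw [exp_le_one_iff]; linarith
    linarith
  have hc := csq x
  have h4 : cosh x - 1 ≤ sinh x ^ 2 / 2 := by nlinarith
  generalize sinh x = S at *
  generalize cosh x = C at *
  have a1 : x ^ 2 * S * (1 + C) ≤ 2 * S ^ 3 := by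
    have : x ^ 2 * (1 + C) ≤ 2 * S ^ 2 := by nlinarith
    nlinarith
  have a2 : (S - x) * (1 + C) ^ 2 = 4 * (S - x) + 2 * (S - x) * (C - 1) + (S - x) * S ^ 2 := by
    linear_combination (S - x) * hc
  have a3 : S - x ≤ x * (C - 1) := by linarith
  have a4 : 4 * (S - x) ≤ 2 * x * S ^ 2 := by nlinarith
  have a5 : 2 * (S - x) * (C - 1) ≤ 2 * x * S ^ 2 := by
    have : (S - x) * (C - 1) ≤ (x * S) * S := by
      apply mul_le_mul <;> nlinarith
    nlinarith
  have : 0 < x * S ^ 2 := by positivity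
  have : 0 < x ^ 2 * S := by positivity
  have : 0 < x ^ 3 := by positivity
  nlinarith

lemma Z_anti : StrictAntiOn Z (Ioi 0) := by
  have hd : ∀ x : ℝ, 0 < x → HasDerivAt Z
      (((1 * (1 + cosh x) + x * sinh x) * (sinh x + x) - x * (1 + cosh x) * (cosh x + 1))
        / (sinh x + x) ^ 2 - 3 * T1 x) x := by
    intro x hx
    have hS := sinh_pos_iff.2 hx
    exact (((hasDerivAt_id x).mul ((hasDerivAt_cosh x).const_add 1)).div
      ((hasDerivAt_sinh x).add (hasDerivAt_id x)) (by simp; linarith)).sub ((hT x).const_mul 3)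
  apply strictAntiOn_of_deriv_neg (convex_Ioi 0)
  · exact fun x hx => (hd x hx).continuousAt.continuousWithinAt
  · intro x hx
    rw [interior_Ioi] at hx
    have hx' : 0 < x := hx
    rw [(hd x hx').deriv]
    have hS := sinh_pos_iff.2 hx'
    have hk := key hx'
    have hC := cpos x
    have hc := csq x
    unfold T1
    have : (1 * (1 + cosh x) + x * sinh x) * (sinh x + x) - x * (1 + cosh x) * (cosh x + 1)
       = (sinh x - x) * (1 + cosh x) + x ^ 2 * sinh x := by linear_combination (-x) * hc
    rw [this, sub_neg, mul_div_assoc', div_lt_div_iff₀ (by positivity) hC]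
    nlinarith

lemma Z_eq {x : ℝ} : Z x = x / T1 x - 3 * T x := by
  unfold Z T1; rw [div_div_eq_mul_div]

lemma delta {a x : ℝ} (ha : 0 < a) (hax : a < x) :
    2 * x * (T x - T a) - (x ^ 2 - a ^ 2) * T1 x < 3 * T1 x * (T x - T a) ^ 2 := by
  have hd : ∀ y : ℝ, HasDerivAt
      (fun y => 3 * T1 x * (T x - T y) ^ 2 - 2 * x * (T x - T y) + (x ^ 2 - y ^ 2) * T1 x)
      (3 * T1 x * (2 * (T x - T y) * (- T1 y)) - 2 * x * (- T1 y) + (- (2 * y)) * T1 x) y := by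
    intro y
    have h1 := (hT y).const_sub (T x)
    have h2 := (hasDerivAt_pow 2 y).const_sub (x^2)
    have := (((h1.pow 2).const_mul (3 * T1 x)).sub (h1.const_mul (2 * x))).add (h2.mul_const (T1 x))
    refine this.congr_deriv ?_
    simp
  have hanti : StrictAntiOn
      (fun y => 3 * T1 x * (T x - T y) ^ 2 - 2 * x * (T x - T y) + (x ^ 2 - y ^ 2) * T1 x)
      (Icc a x) := by
    apply strictAntiOn_of_deriv_neg (convex_Icc a x)
    · exact fun y _ => (hd y).continuousAt.continuousWithinAt
    · intro y hy
      rw [interior_Icc] at hy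
      rw [(hd y).deriv]
      have hy0 : 0 < y := ha.trans hy.1
      have hx0 : 0 < x := ha.trans hax
      have hz := Z_anti hy0 hx0 hy.2
      rw [Z_eq, Z_eq] at hz
      have p1 := T1_pos hy0
      have p2 := T1_pos hx0
      have e1 : x = (x / T1 x) * T1 x := by field_simp
      have e2 : y = (y / T1 y) * T1 y := by field_simp
      generalize x / T1 x = X at *
      generalize y / T1 y = Y at *
      have : 0 < T1 x * T1 y := by positivity
      have h5 : X * (T1 x * T1 y) - Y * (T1 x * T1 y) < 3 * (T x - T y) * (T1 x * T1 y) := by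
        nlinarith
      have e3 : x * T1 y = X * (T1 x * T1 y) := by rw [← mul_assoc, ← e1]
      have e4 : y * T1 x = Y * (T1 x * T1 y) := by rw [mul_comm (T1 x), ← mul_assoc, ← e2]
      nlinarith
  have := hanti (left_mem_Icc.2 hax.le) (right_mem_Icc.2 hax.le) hax
  simp at this
  linarith

noncomputable def N (a x : ℝ) : ℝ := (x ^ 2 - a ^ 2) / (T x - T a) - 3 * T x

lemma N_anti {a x y : ℝ} (ha : 0 < a) (hax : a < x) (hxy : x < y) : N a y < N a x := by
  have hd : ∀ x : ℝ, a < x → HasDerivAt (N a)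
      ((2 * x * (T x - T a) - (x ^ 2 - a ^ 2) * T1 x) / (T x - T a) ^ 2 - 3 * T1 x) x := by
    intro x hx
    have := ((((hasDerivAt_pow 2 x).sub_const (a^2)).div ((hT x).sub_const (T a))
      (sub_pos.2 (T_mono ha hx)).ne').sub ((hT x).const_mul 3))
    refine this.congr_deriv ?_
    simp
  have : StrictAntiOn (N a) (Ioi a) := by
    apply strictAntiOn_of_deriv_neg (convex_Ioi a)
    · exact fun x hx => (hd x hx).continuousAt.continuousWithinAt
    · intro x hx
      rw [interior_Ioi] at hx
      rw [(hd x hx).deriv, sub_neg]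
      have h1 := sub_pos.2 (T_mono ha hx)
      rw [div_lt_iff₀ (by positivity)]
      exact delta ha hx
  exact this hax (hax.trans hxy) hxy

lemma hTc (r s : ℝ) : HasDerivAt (fun s => T (r * s)) (r * T1 (r * s)) s := by
  have := (hT (r * s)).comp s ((hasDerivAt_id s).const_mul r)
  refine this.congr_deriv ?_
  simp; ring

lemma hkc (r : ℝ) {s : ℝ} (hs : 0 < s) :
    HasDerivAt (fun s => kk (r * s)) (-(T (r * s) / s * kk (r * s))) s := by
  have := (hkk (r * s)).comp s ((hasDerivAt_id s).const_mul r)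
  refine this.congr_deriv ?_
  unfold T th
  have := cpos (r * s)
  simp
  field_simp

noncomputable def LR (r₁ r₂ r₃ s : ℝ) : ℝ :=
  log (kk (r₃ * s)) - log (kk (r₂ * s)) + log (T (r₃ * s) - T (r₁ * s))
    - log (T (r₂ * s) - T (r₁ * s))

lemma LR_anti {r₁ r₂ r₃ : ℝ} (h1 : 0 < r₁) (h12 : r₁ < r₂) (h23 : r₂ < r₃) :
    StrictAntiOn (LR r₁ r₂ r₃) (Ioi 0) := by
  have p : ∀ s : ℝ, 0 < s → ∀ r, r₁ < r → 0 < T (r * s) - T (r₁ * s) := by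
    intro s hs r hr
    exact sub_pos.2 (T_mono (by positivity) (by nlinarith))
  have hd : ∀ s : ℝ, 0 < s → HasDerivAt (LR r₁ r₂ r₃)
      (-(T (r₃ * s) / s * kk (r₃ * s)) / kk (r₃ * s) - -(T (r₂ * s) / s * kk (r₂ * s)) / kk (r₂ * s)
      + (r₃ * T1 (r₃ * s) - r₁ * T1 (r₁ * s)) / (T (r₃ * s) - T (r₁ * s))
      - (r₂ * T1 (r₂ * s) - r₁ * T1 (r₁ * s)) / (T (r₂ * s) - T (r₁ * s))) s := by
    intro s hs
    exact ((((hkc r₃ hs).log (kk_pos _).ne').sub ((hkc r₂ hs).log (kk_pos _).ne')).add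
      (((hTc r₃ s).sub (hTc r₁ s)).log (p s hs _ (h12.trans h23)).ne')).sub
      (((hTc r₂ s).sub (hTc r₁ s)).log (p s hs _ h12).ne')
  apply strictAntiOn_of_deriv_neg (convex_Ioi 0)
  · exact fun s hs => (hd s hs).continuousAt.continuousWithinAt
  · intro s hs
    rw [interior_Ioi] at hs
    have hs' : 0 < s := hs
    rw [(hd s hs').deriv]
    have hN := N_anti (a := r₁ * s) (x := r₂ * s) (y := r₃ * s) (by positivity) (by nlinarith)
      (by nlinarith)
    have q3 := p s hs' _ (h12.trans h23)
    have q2 := p s hs' _ h12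
    have e : ∀ r, 0 < T (r * s) - T (r₁ * s) →
        s * ((r * T1 (r * s) - r₁ * T1 (r₁ * s)) / (T (r * s) - T (r₁ * s)))
        = 1 + (1/2) * (N (r₁ * s) (r * s) + 2 * T (r * s) - T (r₁ * s)) := by
      intro r hr
      have a1 := xT1 (r * s)
      have a2 := xT1 (r₁ * s)
      unfold N
      have hr' := hr.ne'
      generalize T (r * s) = A at *
      generalize T (r₁ * s) = B at *
      generalize T1 (r * s) = A1 at *
      generalize T1 (r₁ * s) = B1 at *
      field_simp
      linear_combination 2 * a1 - 2 * a2
    have e3 := e r₃ q3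
    have e2 := e r₂ q2
    have f3 : -(T (r₃ * s) / s * kk (r₃ * s)) / kk (r₃ * s) = -(T (r₃ * s) / s) := by
      have := (kk_pos (r₃ * s)).ne'
      field_simp
    have f2 : -(T (r₂ * s) / s * kk (r₂ * s)) / kk (r₂ * s) = -(T (r₂ * s) / s) := by
      have := (kk_pos (r₂ * s)).ne'
      field_simp
    rw [f3, f2]
    have g3 : s * (T (r₃ * s) / s) = T (r₃ * s) := by field_simp
    have g2 : s * (T (r₂ * s) / s) = T (r₂ * s) := by field_simp
    by_contra hcon
    push Not at hcon
    have := mul_nonneg hs'.le hcon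
    nlinarith

lemma rolle {f f' : ℝ → ℝ} (hf : ∀ x, 0 < x → HasDerivAt f (f' x) x) {a b : ℝ} (ha : 0 < a)
    (hab : a < b) (h : f a = f b) : ∃ c, a < c ∧ c < b ∧ f' c = 0 := by
  obtain ⟨c, hc, h⟩ := exists_hasDerivAt_eq_zero (f' := f') hab
    (fun x hx => (hf x (ha.trans_le hx.1)).continuousAt.continuousWithinAt) h
    (fun x hx => hf x (ha.trans hx.1))
  exact ⟨c, hc.1, hc.2, h⟩

lemma hP (r₁ r : ℝ) {s : ℝ} (hs : 0 < s) :
    HasDerivAt (fun s => kk (r * s) / kk (r₁ * s))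
      (kk (r * s) / kk (r₁ * s) * ((T (r₁ * s) - T (r * s)) / s)) s := by
  refine ((hkc r hs).div (hkc r₁ hs) (kk_pos _).ne').congr_deriv ?_
  have := (kk_pos (r₁ * s)).ne'
  field_simp
  ring

/-- order two -/
lemma tp2 {r₁ r₂ : ℝ} (h1 : 0 < r₁) (h12 : r₁ < r₂) {u v : ℝ} (hu : 0 < u) (huv : u < v)
    {b₁ b₂ : ℝ} (e1 : b₁ * kk (r₁ * u) + b₂ * kk (r₂ * u) = 0)
    (e2 : b₁ * kk (r₁ * v) + b₂ * kk (r₂ * v) = 0) : b₁ = 0 ∧ b₂ = 0 := by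
  have e : ∀ s, b₁ * kk (r₁ * s) + b₂ * kk (r₂ * s) = 0 →
      b₂ * (kk (r₂ * s) / kk (r₁ * s)) = - b₁ := by
    intro s h
    have := (kk_pos (r₁ * s)).ne'
    generalize kk (r₁ * s) = A at *
    generalize kk (r₂ * s) = B at *
    field_simp
    linarith
  obtain ⟨c, hc1, hc2, hc⟩ := rolle (fun s hs => (hP r₁ r₂ hs).const_mul b₂) hu huv
    ((e u e1).trans (e v e2).symm)
  have hc0 := hu.trans hc1
  have hT := T_mono (a := r₁ * c) (b := r₂ * c) (by positivity) (by nlinarith)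
  have hb : b₂ = 0 := by
    have k1 := kk_pos (r₁ * c)
    have k2 := kk_pos (r₂ * c)
    have : kk (r₂ * c) / kk (r₁ * c) * ((T (r₁ * c) - T (r₂ * c)) / c) ≠ 0 := by
      have : T (r₁ * c) - T (r₂ * c) ≠ 0 := by linarith
      positivity
    exact (mul_eq_zero.1 hc).resolve_right this
  refine ⟨?_, hb⟩
  have := e u e1
  rw [hb] at this
  linarith

/-- order three -/
lemma tp3 {r₁ r₂ r₃ : ℝ} (h1 : 0 < r₁) (h12 : r₁ < r₂) (h23 : r₂ < r₃) {u v w : ℝ} (hu : 0 < u)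
    (huv : u < v) (hvw : v < w) {b₁ b₂ b₃ : ℝ}
    (e1 : b₁ * kk (r₁ * u) + b₂ * kk (r₂ * u) + b₃ * kk (r₃ * u) = 0)
    (e2 : b₁ * kk (r₁ * v) + b₂ * kk (r₂ * v) + b₃ * kk (r₃ * v) = 0)
    (e3 : b₁ * kk (r₁ * w) + b₂ * kk (r₂ * w) + b₃ * kk (r₃ * w) = 0) :
    b₁ = 0 ∧ b₂ = 0 ∧ b₃ = 0 := by
  have e : ∀ s, b₁ * kk (r₁ * s) + b₂ * kk (r₂ * s) + b₃ * kk (r₃ * s) = 0 →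
      b₂ * (kk (r₂ * s) / kk (r₁ * s)) + b₃ * (kk (r₃ * s) / kk (r₁ * s)) = - b₁ := by
    intro s h
    have := (kk_pos (r₁ * s)).ne'
    generalize kk (r₁ * s) = A at *
    generalize kk (r₂ * s) = B at *
    generalize kk (r₃ * s) = C at *
    field_simp
    linarith
  have hd := fun s (hs : 0 < s) => ((hP r₁ r₂ hs).const_mul b₂).add ((hP r₁ r₃ hs).const_mul b₃)
  obtain ⟨c, hc1, hc2, hc⟩ := rolle hd hu huv ((e u e1).trans (e v e2).symm)
  obtain ⟨d, hd1, hd2, hd⟩ := rolle hd (hu.trans huv) hvw ((e v e2).trans (e w e3).symm)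
  have k : ∀ s, 0 < s → b₂ * (kk (r₂ * s) / kk (r₁ * s) * ((T (r₁ * s) - T (r₂ * s)) / s)) +
      b₃ * (kk (r₃ * s) / kk (r₁ * s) * ((T (r₁ * s) - T (r₃ * s)) / s)) = 0 →
      b₃ * rexp (LR r₁ r₂ r₃ s) = - b₂ := by
    intro s hs h
    have t2 : 0 < T (r₂ * s) - T (r₁ * s) :=
      sub_pos.2 (T_mono (by positivity) (by nlinarith))
    have t3 : 0 < T (r₃ * s) - T (r₁ * s) :=
      sub_pos.2 (T_mono (by positivity) (by nlinarith))
    have k1 := kk_pos (r₁ * s)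
    have k2 := kk_pos (r₂ * s)
    have k3 := kk_pos (r₃ * s)
    unfold LR
    rw [exp_sub, exp_add, exp_sub, exp_log k2, exp_log k3, exp_log t2, exp_log t3]
    have t2' := t2.ne'
    clear e1 e2 e3 e hc hd
    generalize kk (r₁ * s) = A at *
    generalize kk (r₂ * s) = B at *
    generalize kk (r₃ * s) = C at *
    generalize T (r₁ * s) = A' at *
    generalize T (r₂ * s) = B' at *
    generalize T (r₃ * s) = C' at *
    have h' : b₂ * B * (A' - B') + b₃ * C * (A' - C') = 0 := by
      have : b₂ * (B / A * ((A' - B') / s)) + b₃ * (C / A * ((A' - C') / s))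
        = (b₂ * B * (A' - B') + b₃ * C * (A' - C')) / (A * s) := by field_simp
      rw [this] at h
      exact (div_eq_zero_iff.1 h).resolve_right (by positivity)
    field_simp
    linarith
  have hc0 := hu.trans hc1
  have hd0 := (hu.trans huv).trans hd1
  have f1 := k c hc0 hc
  have f2 := k d hd0 hd
  have hL := LR_anti h1 h12 h23 hc0 hd0 (hc2.trans hd1)
  have hL' := exp_lt_exp.2 hL
  have b3 : b₃ = 0 := by
    have : b₃ * (rexp (LR r₁ r₂ r₃ c) - rexp (LR r₁ r₂ r₃ d)) = 0 := by linarith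
    exact (mul_eq_zero.1 this).resolve_right (by linarith)
  have b2 : b₂ = 0 := by rw [b3] at f1; linarith
  refine ⟨?_, b2, b3⟩
  have := e u e1
  rw [b2, b3] at this
  linarith

noncomputable def g (x : ℝ) : ℝ := log (1 + rexp (-x))
noncomputable def h (x : ℝ) : ℝ := - x / (1 + rexp x) - g x
noncomputable def F (s q : ℝ) : ℝ := g (s * q) - q * g s

lemma hg (x : ℝ) : HasDerivAt g (-1 / (1 + rexp x)) x := by
  have h1 : HasDerivAt (fun x => 1 + rexp (-x)) (rexp (-x) * (-1)) x :=
    ((hasDerivAt_neg x).exp).const_add 1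
  have := h1.log (by positivity)
  refine this.congr_deriv ?_
  rw [exp_neg]
  have := exp_pos x
  field_simp
  ring

lemma hh (x : ℝ) : HasDerivAt h (x * kk x / 2) x := by
  have h1 : HasDerivAt (fun x => 1 + rexp x) (rexp x) x := (hasDerivAt_exp x).const_add 1
  have := ((hasDerivAt_neg x).div h1 (by positivity)).sub (hg x)
  refine this.congr_deriv ?_
  unfold kk
  rw [cosh_eq, exp_neg]
  have := exp_pos x
  field_simp
  ring

lemma hhc (r s : ℝ) : HasDerivAt (fun s => h (s * r)) (s / 2 * (r ^ 2 * kk (r * s))) s := by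
  have := (hh (s * r)).comp s ((hasDerivAt_id s).mul_const r)
  refine this.congr_deriv ?_
  rw [mul_comm s r]; simp; ring

lemma hF (s q : ℝ) : HasDerivAt (F s) (s * (-1 / (1 + rexp (s * q))) - g s) q := by
  have := ((hg (s * q)).comp q ((hasDerivAt_id q).const_mul s)).sub
    ((hasDerivAt_id q).mul_const (g s))
  refine this.congr_deriv ?_
  simp; ring

lemma hF_h (s q : ℝ) : q * (s * (-1 / (1 + rexp (s * q))) - g s) - F s q = h (s * q) := by
  unfold F h; ring

lemma hFq (s : ℝ) {q : ℝ} (hq : 0 < q) : HasDerivAt (fun q => F s q / q) (h (s * q) / q ^ 2) q := by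
  refine ((hF s q).div (hasDerivAt_id q) hq.ne').congr_deriv ?_
  rw [← hF_h]; simp; ring

lemma F_one (s : ℝ) : F s 1 = 0 := by unfold F; simp

lemma hs1 (s r : ℝ) : HasDerivAt (fun s => F s r) (r * (1 / (1 + rexp s) - 1 / (1 + rexp (s * r)))) s := by
  have := ((hg (s * r)).comp s ((hasDerivAt_id s).mul_const r)).sub ((hg s).const_mul r)
  refine this.congr_deriv ?_
  simp; ring

lemma F_mono {s t q : ℝ} (hs : 0 < s) (hst : s < t) (hq : 1 < q) : F s q < F t q := by
  have : StrictMonoOn (fun s => F s q) (Ioi 0) := by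
    apply strictMonoOn_of_deriv_pos (convex_Ioi 0)
    · exact fun x _ => (hs1 x q).continuousAt.continuousWithinAt
    · intro x hx
      rw [interior_Ioi] at hx
      have hx' : 0 < x := hx
      rw [(hs1 x q).deriv]
      apply mul_pos (by linarith)
      rw [sub_pos]
      apply one_div_lt_one_div_of_lt (by positivity)
      have : rexp x < rexp (x * q) := exp_lt_exp.2 (by nlinarith)
      linarith
  exact this hs (hs.trans hst) hst

lemma B3 {s₀ s₁ s₂ r₀ r₁ : ℝ} (h0 : 0 < s₀) (h01 : s₀ < s₁) (h12 : s₁ < s₂)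
    (hr : 0 < r₀) (hr01 : r₀ < r₁) {c₀ c₁ c₂ : ℝ} (hc : c₀ + c₁ + c₂ = 0)
    (e0 : c₀ * h (s₀ * r₀) + c₁ * h (s₁ * r₀) + c₂ * h (s₂ * r₀) = 0)
    (e1 : c₀ * h (s₀ * r₁) + c₁ * h (s₁ * r₁) + c₂ * h (s₂ * r₁) = 0) :
    c₀ = 0 ∧ c₁ = 0 ∧ c₂ = 0 := by
  let M : Matrix (Fin 3) (Fin 3) ℝ := !![1, h (s₀ * r₀), h (s₀ * r₁);
    1, h (s₁ * r₀), h (s₁ * r₁); 1, h (s₂ * r₀), h (s₂ * r₁)]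
  by_contra hcon
  have hdet : M.det = 0 := by
    rw [← Matrix.exists_vecMul_eq_zero_iff]
    refine ⟨![c₀, c₁, c₂], ?_, ?_⟩
    · intro hz
      exact hcon ⟨congrFun hz 0, congrFun hz 1, congrFun hz 2⟩
    · ext j
      fin_cases j <;> simp [M, Matrix.vecMul, dotProduct, Fin.sum_univ_succ] <;> linarith
  rw [← Matrix.exists_mulVec_eq_zero_iff] at hdet
  obtain ⟨b, hb, hMb⟩ := hdet
  have m0 := congrFun hMb 0
  have m1 := congrFun hMb 1
  have m2 := congrFun hMb 2
  simp [M, Matrix.mulVec, dotProduct, Fin.sum_univ_succ] at m0 m1 m2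
  have hd := fun s (_ : 0 < s) => ((hhc r₀ s).const_mul (b 1)).add ((hhc r₁ s).const_mul (b 2))
  obtain ⟨u, u1, u2, hu⟩ := rolle hd h0 h01 (by simp only [Pi.add_apply]; linarith)
  obtain ⟨v, v1, v2, hv⟩ := rolle hd (h0.trans h01) h12 (by simp only [Pi.add_apply]; linarith)
  have k : ∀ s, 0 < s → b 1 * (s / 2 * (r₀ ^ 2 * kk (r₀ * s))) +
      b 2 * (s / 2 * (r₁ ^ 2 * kk (r₁ * s))) = 0 →
      (b 1 * r₀ ^ 2) * kk (r₀ * s) + (b 2 * r₁ ^ 2) * kk (r₁ * s) = 0 := by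
    intro s hs hz
    have : s / 2 * ((b 1 * r₀ ^ 2) * kk (r₀ * s) + (b 2 * r₁ ^ 2) * kk (r₁ * s)) = 0 := by
      linarith
    exact (mul_eq_zero.1 this).resolve_left (by positivity)
  have u0 := h0.trans u1
  have v0 := (h0.trans h01).trans v1
  obtain ⟨b1, b2⟩ := tp2 hr hr01 u0 (u2.trans v1) (k u u0 hu) (k v v0 hv)
  have hr1 := hr.trans hr01
  have b1' : b 1 = 0 := (mul_eq_zero.1 b1).resolve_right (by positivity)
  have b2' : b 2 = 0 := (mul_eq_zero.1 b2).resolve_right (by positivity)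
  have b0' : b 0 = 0 := by rw [b1', b2'] at m0; linarith
  apply hb
  ext j
  fin_cases j <;> simp [b0', b1', b2']

lemma B4 {s₀ s₁ s₂ s₃ r₀ r₁ r₂ : ℝ} (h0 : 0 < s₀) (h01 : s₀ < s₁) (h12 : s₁ < s₂) (h23 : s₂ < s₃)
    (hr : 0 < r₀) (hr01 : r₀ < r₁) (hr12 : r₁ < r₂) {c₀ c₁ c₂ c₃ : ℝ} (hc : c₀ + c₁ + c₂ + c₃ = 0)
    (e0 : c₀ * h (s₀ * r₀) + c₁ * h (s₁ * r₀) + c₂ * h (s₂ * r₀) + c₃ * h (s₃ * r₀) = 0)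
    (e1 : c₀ * h (s₀ * r₁) + c₁ * h (s₁ * r₁) + c₂ * h (s₂ * r₁) + c₃ * h (s₃ * r₁) = 0)
    (e2 : c₀ * h (s₀ * r₂) + c₁ * h (s₁ * r₂) + c₂ * h (s₂ * r₂) + c₃ * h (s₃ * r₂) = 0) :
    c₀ = 0 ∧ c₁ = 0 ∧ c₂ = 0 ∧ c₃ = 0 := by
  let M : Matrix (Fin 4) (Fin 4) ℝ := !![1, h (s₀ * r₀), h (s₀ * r₁), h (s₀ * r₂);
    1, h (s₁ * r₀), h (s₁ * r₁), h (s₁ * r₂); 1, h (s₂ * r₀), h (s₂ * r₁), h (s₂ * r₂);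
    1, h (s₃ * r₀), h (s₃ * r₁), h (s₃ * r₂)]
  by_contra hcon
  have hdet : M.det = 0 := by
    rw [← Matrix.exists_vecMul_eq_zero_iff]
    refine ⟨![c₀, c₁, c₂, c₃], ?_, ?_⟩
    · intro hz
      exact hcon ⟨congrFun hz 0, congrFun hz 1, congrFun hz 2, congrFun hz 3⟩
    · ext j
      fin_cases j <;> simp [M, Matrix.vecMul, dotProduct, Fin.sum_univ_succ] <;> linarith
  rw [← Matrix.exists_mulVec_eq_zero_iff] at hdet
  obtain ⟨b, hb, hMb⟩ := hdet
  have m0 := congrFun hMb 0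
  have m1 := congrFun hMb 1
  have m2 := congrFun hMb 2
  have m3 := congrFun hMb 3
  simp [M, Matrix.mulVec, dotProduct, Fin.sum_univ_four] at m0 m1 m2 m3
  have hd := fun s (_ : 0 < s) => (((hhc r₀ s).const_mul (b 1)).add
    ((hhc r₁ s).const_mul (b 2))).add ((hhc r₂ s).const_mul (b 3))
  have h1 := h0.trans h01
  have h2 := h1.trans h12
  obtain ⟨u, u1, u2, hu⟩ := rolle hd h0 h01 (by simp only [Pi.add_apply]; linarith)
  obtain ⟨v, v1, v2, hv⟩ := rolle hd h1 h12 (by simp only [Pi.add_apply]; linarith)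
  obtain ⟨w, w1, w2, hw⟩ := rolle hd h2 h23 (by simp only [Pi.add_apply]; linarith)
  have k : ∀ s, 0 < s → b 1 * (s / 2 * (r₀ ^ 2 * kk (r₀ * s))) +
      b 2 * (s / 2 * (r₁ ^ 2 * kk (r₁ * s))) + b 3 * (s / 2 * (r₂ ^ 2 * kk (r₂ * s))) = 0 →
      (b 1 * r₀ ^ 2) * kk (r₀ * s) + (b 2 * r₁ ^ 2) * kk (r₁ * s)
        + (b 3 * r₂ ^ 2) * kk (r₂ * s) = 0 := by
    intro s hs hz
    have : s / 2 * ((b 1 * r₀ ^ 2) * kk (r₀ * s) + (b 2 * r₁ ^ 2) * kk (r₁ * s)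
        + (b 3 * r₂ ^ 2) * kk (r₂ * s)) = 0 := by
      linarith
    exact (mul_eq_zero.1 this).resolve_left (by positivity)
  obtain ⟨b1, b2, b3⟩ := tp3 hr hr01 hr12 (h0.trans u1) (u2.trans v1) (v2.trans w1)
    (k u (h0.trans u1) hu) (k v (h1.trans v1) hv) (k w (h2.trans w1) hw)
  have hr1 := hr.trans hr01
  have hr2 := hr1.trans hr12
  have b1' : b 1 = 0 := (mul_eq_zero.1 b1).resolve_right (by positivity)
  have b2' : b 2 = 0 := (mul_eq_zero.1 b2).resolve_right (by positivity)
  have b3' : b 3 = 0 := (mul_eq_zero.1 b3).resolve_right (by positivity)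
  have b0' : b 0 = 0 := by rw [b1', b2', b3'] at m0; linarith
  apply hb
  ext j
  fin_cases j <;> simp [b0', b1', b2', b3']

noncomputable def D3 (c₀ c₁ c₂ s₀ s₁ s₂ q : ℝ) : ℝ := c₀ * F s₀ q + c₁ * F s₁ q + c₂ * F s₂ q

noncomputable def D4 (c₀ c₁ c₂ c₃ s₀ s₁ s₂ s₃ q : ℝ) : ℝ :=
  c₀ * F s₀ q + c₁ * F s₁ q + c₂ * F s₂ q + c₃ * F s₃ q

lemma C3 {s₀ s₁ s₂ q₁ q₂ : ℝ} (h0 : 0 < s₀) (h01 : s₀ < s₁) (h12 : s₁ < s₂)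
    (hq : 1 < q₁) (hq12 : q₁ < q₂) {c₀ c₁ c₂ : ℝ} (hc : c₀ + c₁ + c₂ = 0)
    (e0 : D3 c₀ c₁ c₂ s₀ s₁ s₂ q₁ = 0) (e1 : D3 c₀ c₁ c₂ s₀ s₁ s₂ q₂ = 0) :
    c₀ = 0 ∧ c₁ = 0 ∧ c₂ = 0 := by
  have hd : ∀ q, 0 < q → HasDerivAt (fun q => D3 c₀ c₁ c₂ s₀ s₁ s₂ q / q)
      ((c₀ * h (s₀ * q) + c₁ * h (s₁ * q) + c₂ * h (s₂ * q)) / q ^ 2) q := by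
    intro q hq
    have := (((hFq s₀ hq).const_mul c₀).add ((hFq s₁ hq).const_mul c₁)).add
      ((hFq s₂ hq).const_mul c₂)
    refine (this.congr_deriv ?_).congr_of_eventuallyEq (Filter.Eventually.of_forall fun q => ?_)
    · ring
    · simp only [D3, Pi.add_apply]; ring
  have k : ∀ q, 0 < q → (c₀ * h (s₀ * q) + c₁ * h (s₁ * q) + c₂ * h (s₂ * q)) / q ^ 2 = 0 →
      c₀ * h (s₀ * q) + c₁ * h (s₁ * q) + c₂ * h (s₂ * q) = 0 := by
    intro q hq hz
    exact (div_eq_zero_iff.1 hz).resolve_right (by positivity)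
  obtain ⟨u, u1, u2, hu⟩ := rolle hd one_pos hq (by rw [e0]; simp [D3, F_one])
  obtain ⟨v, v1, v2, hv⟩ := rolle hd (by linarith) hq12 (by rw [e0, e1]; simp)
  exact B3 h0 h01 h12 (by linarith) (u2.trans v1) hc (k u (by linarith) hu) (k v (by linarith) hv)

lemma hD4 (c₀ c₁ c₂ c₃ s₀ s₁ s₂ s₃ : ℝ) :
   ∀ q, 0 < q → HasDerivAt (fun q => D4 c₀ c₁ c₂ c₃ s₀ s₁ s₂ s₃ q / q)
      ((c₀ * h (s₀ * q) + c₁ * h (s₁ * q) + c₂ * h (s₂ * q) + c₃ * h (s₃ * q)) / q ^ 2) q := by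
  intro q hq
  have := ((((hFq s₀ hq).const_mul c₀).add ((hFq s₁ hq).const_mul c₁)).add
      ((hFq s₂ hq).const_mul c₂)).add ((hFq s₃ hq).const_mul c₃)
  refine (this.congr_deriv ?_).congr_of_eventuallyEq (Filter.Eventually.of_forall fun q => ?_)
  · ring
  · simp only [D4, Pi.add_apply]; ring

lemma C4 {s₀ s₁ s₂ s₃ q₁ q₂ q₃ : ℝ} (h0 : 0 < s₀) (h01 : s₀ < s₁) (h12 : s₁ < s₂) (h23 : s₂ < s₃)
    (hq : 1 < q₁) (hq12 : q₁ < q₂) (hq23 : q₂ < q₃) {c₀ c₁ c₂ c₃ : ℝ} (hc : c₀ + c₁ + c₂ + c₃ = 0)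
    (e0 : D4 c₀ c₁ c₂ c₃ s₀ s₁ s₂ s₃ q₁ = 0) (e1 : D4 c₀ c₁ c₂ c₃ s₀ s₁ s₂ s₃ q₂ = 0)
    (e2 : D4 c₀ c₁ c₂ c₃ s₀ s₁ s₂ s₃ q₃ = 0) :
    c₀ = 0 ∧ c₁ = 0 ∧ c₂ = 0 ∧ c₃ = 0 := by
  have hd := hD4 c₀ c₁ c₂ c₃ s₀ s₁ s₂ s₃
  have k : ∀ q, 0 < q →
      (c₀ * h (s₀ * q) + c₁ * h (s₁ * q) + c₂ * h (s₂ * q) + c₃ * h (s₃ * q)) / q ^ 2 = 0 →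
      c₀ * h (s₀ * q) + c₁ * h (s₁ * q) + c₂ * h (s₂ * q) + c₃ * h (s₃ * q) = 0 := by
    intro q hq hz
    exact (div_eq_zero_iff.1 hz).resolve_right (by positivity)
  obtain ⟨u, u1, u2, hu⟩ := rolle hd one_pos hq (by rw [e0]; simp [D4, F_one])
  obtain ⟨v, v1, v2, hv⟩ := rolle hd (by linarith) hq12 (by rw [e0, e1]; simp)
  obtain ⟨w, w1, w2, hw⟩ := rolle hd (by linarith) hq23 (by rw [e1, e2]; simp)
  exact B4 h0 h01 h12 h23 (by linarith) (u2.trans v1) (v2.trans w1) hc (k u (by linarith) hu)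
    (k v (by linarith) hv) (k w (by linarith) hw)

lemma C4d {s₀ s₁ s₂ s₃ q₁ q₂ q₃ : ℝ} (h0 : 0 < s₀) (h01 : s₀ < s₁) (h12 : s₁ < s₂) (h23 : s₂ < s₃)
    (hq : 1 < q₁) (hq12 : q₁ < q₂) {c₀ c₁ c₂ c₃ : ℝ} (hc : c₀ + c₁ + c₂ + c₃ = 0)
    (e0 : D4 c₀ c₁ c₂ c₃ s₀ s₁ s₂ s₃ q₁ = 0) (e1 : D4 c₀ c₁ c₂ c₃ s₀ s₁ s₂ s₃ q₂ = 0)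
    (hq3 : q₃ = q₁ ∨ q₃ = q₂)
    (e2 : HasDerivAt (D4 c₀ c₁ c₂ c₃ s₀ s₁ s₂ s₃) 0 q₃) :
    c₀ = 0 ∧ c₁ = 0 ∧ c₂ = 0 ∧ c₃ = 0 := by
  have hd := hD4 c₀ c₁ c₂ c₃ s₀ s₁ s₂ s₃
  have k : ∀ q, 0 < q →
      (c₀ * h (s₀ * q) + c₁ * h (s₁ * q) + c₂ * h (s₂ * q) + c₃ * h (s₃ * q)) / q ^ 2 = 0 →
      c₀ * h (s₀ * q) + c₁ * h (s₁ * q) + c₂ * h (s₂ * q) + c₃ * h (s₃ * q) = 0 := by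
    intro q hq hz
    exact (div_eq_zero_iff.1 hz).resolve_right (by positivity)
  obtain ⟨u, u1, u2, hu⟩ := rolle hd one_pos hq (by rw [e0]; simp [D4, F_one])
  obtain ⟨v, v1, v2, hv⟩ := rolle hd (by linarith) hq12 (by rw [e0, e1]; simp)
  have q30 : 0 < q₃ := by rcases hq3 with h | h <;> linarith
  have hz : D4 c₀ c₁ c₂ c₃ s₀ s₁ s₂ s₃ q₃ = 0 := by rcases hq3 with h | h <;> rw [h] <;> assumption
  have hw : (c₀ * h (s₀ * q₃) + c₁ * h (s₁ * q₃) + c₂ * h (s₂ * q₃) + c₃ * h (s₃ * q₃)) / q₃ ^ 2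
      = 0 := by
    have := (e2.div (hasDerivAt_id q₃) q30.ne').unique (hd q₃ q30)
    rw [← this, hz]; simp
  have kw := k q₃ q30 hw
  have ku := k u (by linarith) hu
  have kv := k v (by linarith) hv
  rcases hq3 with rfl | rfl
  · exact B4 h0 h01 h12 h23 (by linarith) u2 v1 hc ku kw kv
  · exact B4 h0 h01 h12 h23 (by linarith) (u2.trans v1) v2 hc ku kv kw

noncomputable def W (q₁ q₂ a b c : ℝ) : ℝ :=
  (F a q₁ - F b q₁) * (F b q₂ - F c q₂) - (F a q₂ - F b q₂) * (F b q₁ - F c q₁)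

lemma W_ne {q₁ q₂ a b c : ℝ} (hq : 1 < q₁) (hq12 : q₁ < q₂) (hc : 0 < c) (hcb : c < b)
    (hba : b < a) : W q₁ q₂ a b c ≠ 0 := by
  intro hW
  unfold W at hW
  have := C3 (c₀ := F a q₁ - F b q₁) (c₁ := F c q₁ - F a q₁) (c₂ := F b q₁ - F c q₁)
    hc hcb hba hq hq12 (by ring) (by unfold D3; ring) (by unfold D3; linarith)
  have h1 := this.1
  have := F_mono (hc.trans hcb) hba hq
  linarith

lemma same_sign {φ : ℝ → ℝ} {a b : ℝ} (hab : a ≤ b) (hφ : Continuous φ)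
    (hn : ∀ x, a ≤ x → x ≤ b → φ x ≠ 0) : 0 < φ a * φ b := by
  by_contra hcon
  have : (0:ℝ) ∈ uIcc (φ a) (φ b) := by
    rw [mem_uIcc]
    by_contra h2
    push Not at h2
    apply hcon
    rcases lt_trichotomy (φ a) 0 with ha | ha | ha
    · exact mul_pos_of_neg_of_neg ha (h2.1 ha.le)
    · exact absurd ha (hn a le_rfl hab)
    · rcases lt_trichotomy (φ b) 0 with hb | hb | hb
      · have := h2.2 hb.le; linarith
      · exact absurd hb (hn b hab le_rfl)
      · positivity
  obtain ⟨x, hx, h⟩ := intermediate_value_uIcc (hφ.continuousOn) this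
  rw [uIcc_of_le hab] at hx
  exact hn x hx.1 hx.2 h

lemma Fc (q : ℝ) : Continuous fun s => F s q :=
  continuous_iff_continuousAt.2 fun s => (hs1 s q).continuousAt

noncomputable def sp (p : ℝ) : ℝ := log ((1 - p) / p)

lemma sp_pos {p : ℝ} (h0 : 0 < p) (h1 : p < 1 / 2) : 0 < sp p := by
  apply log_pos
  rw [lt_div_iff₀ h0]; linarith

lemma sp_anti {p p' : ℝ} (h0 : 0 < p) (h : p < p') (h1 : p' < 1 / 2) : sp p' < sp p := by
  apply log_lt_log
  · apply div_pos <;> linarith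
  · rw [div_lt_div_iff₀ (by linarith) h0]; nlinarith

lemma tau_eq {p : ℝ} (h0 : 0 < p) (h1 : p < 1 / 2) (q : ℝ) : tauP p q = F (sp p) q / log 2 := by
  have hp : 0 < 1 - p := by linarith
  have hr : 0 < (1 - p) / p := by positivity
  unfold tauP logb
  congr 1
  have e1 : rexp (-(sp p)) = p / (1 - p) := by
    unfold sp; rw [exp_neg, exp_log hr, inv_div]
  have e2 : rexp (-(sp p * q)) = p ^ q / (1 - p) ^ q := by
    rw [← div_rpow h0.le hp.le, ← e1, ← exp_mul]; congr 1; ring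
  unfold F g
  rw [e1, e2]
  have hq : 0 < (1 - p) ^ q := rpow_pos_of_pos hp q
  have hq' : 0 < p ^ q := rpow_pos_of_pos h0 q
  rw [show 1 + p / (1 - p) = (1 - p)⁻¹ by field_simp; ring,
    show 1 + p ^ q / (1 - p) ^ q = (p ^ q + (1 - p) ^ q) / (1 - p) ^ q by field_simp; ring,
    log_inv, log_div (by positivity) hq.ne', log_rpow hp]
  ring

end S16

/-- **Lemma 4.3.** Given `τ = λ₁ τ(p₁,·) + λ₂ τ(p₂,·)`, `1 < q₁ < q₂`,
`p₁ < p₄ < p₂ < p₅ < 1/2` with `τ(p₄,q₁) = τ(q₁)`, there is a unique convex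
combination `τ̃ = λ₃ τ(p₁,·) + λ₄ τ(p₄,·) + λ₅ τ(p₅,·)` (with strictly positive
coefficients) such that `τ̃(qᵢ) = τ(qᵢ)` for `i = 1,2`; moreover `τ̃'(qᵢ) ≠ τ'(qᵢ)` and
`τ̃(q) ≠ τ(q)` for every `q > 1`, `q ∉ {q₁, q₂}`. -/
theorem stmt16 (lam₁ lam₂ : ℝ) (hl₁ : lam₁ ∈ Set.Ioo (0:ℝ) 1)
    (hl₂ : lam₂ ∈ Set.Ioo (0:ℝ) 1) (hsum : lam₁ + lam₂ = 1)
    (p₁ p₂ p₄ p₅ : ℝ) (h₁ : 0 < p₁) (h₁₂ : p₁ < p₂) (h₂ : p₂ < 1 / 2)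
    (q₁ q₂ : ℝ) (hq₁ : 1 < q₁) (hq₁₂ : q₁ < q₂)
    (h₁₄ : p₁ < p₄) (h₄₂ : p₄ < p₂) (h₂₅ : p₂ < p₅) (h₅ : p₅ < 1 / 2)
    (hp₄ : tauP p₄ q₁ = lam₁ * tauP p₁ q₁ + lam₂ * tauP p₂ q₁) :
    (∃! L : ℝ × ℝ × ℝ,
      (0 < L.1 ∧ 0 < L.2.1 ∧ 0 < L.2.2 ∧ L.1 + L.2.1 + L.2.2 = 1) ∧
      (L.1 * tauP p₁ q₁ + L.2.1 * tauP p₄ q₁ + L.2.2 * tauP p₅ q₁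
          = lam₁ * tauP p₁ q₁ + lam₂ * tauP p₂ q₁) ∧
      (L.1 * tauP p₁ q₂ + L.2.1 * tauP p₄ q₂ + L.2.2 * tauP p₅ q₂
          = lam₁ * tauP p₁ q₂ + lam₂ * tauP p₂ q₂)) ∧
    ∀ L : ℝ × ℝ × ℝ,
      (0 < L.1 ∧ 0 < L.2.1 ∧ 0 < L.2.2 ∧ L.1 + L.2.1 + L.2.2 = 1) →
      (L.1 * tauP p₁ q₁ + L.2.1 * tauP p₄ q₁ + L.2.2 * tauP p₅ q₁
          = lam₁ * tauP p₁ q₁ + lam₂ * tauP p₂ q₁) →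
      (L.1 * tauP p₁ q₂ + L.2.1 * tauP p₄ q₂ + L.2.2 * tauP p₅ q₂
          = lam₁ * tauP p₁ q₂ + lam₂ * tauP p₂ q₂) →
      (deriv (fun q => L.1 * tauP p₁ q + L.2.1 * tauP p₄ q + L.2.2 * tauP p₅ q) q₁
          ≠ deriv (fun q => lam₁ * tauP p₁ q + lam₂ * tauP p₂ q) q₁) ∧
      (deriv (fun q => L.1 * tauP p₁ q + L.2.1 * tauP p₄ q + L.2.2 * tauP p₅ q) q₂
          ≠ deriv (fun q => lam₁ * tauP p₁ q + lam₂ * tauP p₂ q) q₂) ∧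
      ∀ q : ℝ, 1 < q → q ≠ q₁ → q ≠ q₂ →
        L.1 * tauP p₁ q + L.2.1 * tauP p₄ q + L.2.2 * tauP p₅ q
          ≠ lam₁ * tauP p₁ q + lam₂ * tauP p₂ q := by
  have hl2 : Real.log 2 ≠ 0 := (Real.log_pos (by norm_num)).ne'
  have h2 : 0 < p₂ := by linarith
  have h4 : 0 < p₄ := by linarith
  have h5 : 0 < p₅ := by linarith
  have t1 := fun q => S16.tau_eq h₁ (by linarith) q
  have t2 := fun q => S16.tau_eq h2 h₂ q
  have t4 := fun q => S16.tau_eq h4 (by linarith) q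
  have t5 := fun q => S16.tau_eq h5 h₅ q
  have s5 := S16.sp_pos h5 h₅
  have s52 := S16.sp_anti h2 h₂₅ h₅
  have s24 := S16.sp_anti h4 h₄₂ h₂
  have s41 := S16.sp_anti h₁ h₁₄ (by linarith)
  simp only [t1, t2, t4, t5] at hp₄ ⊢
  clear t1 t2 t4 t5
  generalize S16.sp p₁ = a₁ at *
  generalize S16.sp p₂ = a₂ at *
  generalize S16.sp p₄ = a₄ at *
  generalize S16.sp p₅ = a₅ at *
  have cl3 : ∀ x y z q : ℝ, x * (S16.F a₁ q / Real.log 2) + y * (S16.F a₄ q / Real.log 2)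
      + z * (S16.F a₅ q / Real.log 2) = lam₁ * (S16.F a₁ q / Real.log 2)
      + lam₂ * (S16.F a₂ q / Real.log 2) ↔
      x * S16.F a₁ q + y * S16.F a₄ q + z * S16.F a₅ q
        = lam₁ * S16.F a₁ q + lam₂ * S16.F a₂ q := by
    intro x y z q
    field_simp
  have hp4 : S16.F a₄ q₁ = lam₁ * S16.F a₁ q₁ + lam₂ * S16.F a₂ q₁ := by
    field_simp at hp₄
    exact hp₄
  have hlt2 := hl₂.1
  refine ⟨?_, ?_⟩
  · simp only [cl3]
    have m24 := S16.F_mono (s5.trans s52) s24 hq₁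
    have m41 := S16.F_mono ((s5.trans s52).trans s24) s41 hq₁
    have m52 := S16.F_mono s5 s52 hq₁
    have sgA : 0 < S16.W q₁ q₂ a₁ a₄ a₅ * S16.W q₁ q₂ a₁ a₄ a₂ := by
      apply S16.same_sign (φ := fun x => S16.W q₁ q₂ a₁ a₄ x) s52.le
      · unfold S16.W
        have := S16.Fc q₁
        have := S16.Fc q₂
        fun_prop
      · intro x hx hx'
        exact S16.W_ne hq₁ hq₁₂ (by linarith) (by linarith) (by linarith)
    have sgB : 0 < S16.W q₁ q₂ a₁ a₂ a₅ * S16.W q₁ q₂ a₁ a₄ a₅ := by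
      apply S16.same_sign (φ := fun x => S16.W q₁ q₂ a₁ x a₅) s24.le
      · unfold S16.W
        have := S16.Fc q₁
        have := S16.Fc q₂
        fun_prop
      · intro x hx hx'
        exact S16.W_ne hq₁ hq₁₂ (by linarith) (by linarith) (by linarith)
    have uniq : ∀ L L' : ℝ × ℝ × ℝ, L.1 + L.2.1 + L.2.2 = 1 → L'.1 + L'.2.1 + L'.2.2 = 1 →
        (L.1 * S16.F a₁ q₁ + L.2.1 * S16.F a₄ q₁ + L.2.2 * S16.F a₅ q₁ =
          L'.1 * S16.F a₁ q₁ + L'.2.1 * S16.F a₄ q₁ + L'.2.2 * S16.F a₅ q₁) →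
        (L.1 * S16.F a₁ q₂ + L.2.1 * S16.F a₄ q₂ + L.2.2 * S16.F a₅ q₂ =
          L'.1 * S16.F a₁ q₂ + L'.2.1 * S16.F a₄ q₂ + L'.2.2 * S16.F a₅ q₂) → L = L' := by
      intro L L' hL hL' e1 e2
      obtain ⟨z1, z2, z3⟩ := S16.C3 (c₀ := L.2.2 - L'.2.2) (c₁ := L.2.1 - L'.2.1)
        (c₂ := L.1 - L'.1) s5 (s52.trans s24) s41 hq₁ hq₁₂ (by linarith)
        (by unfold S16.D3; linarith) (by unfold S16.D3; linarith)
      ext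
      · linarith
      · linarith
      · linarith
    have hw := S16.W_ne hq₁ hq₁₂ s5 (s52.trans s24) s41
    set w := S16.W q₁ q₂ a₁ a₄ a₅ with hwd
    set w2 := S16.W q₁ q₂ a₁ a₄ a₂ with hw2d
    set w5 := S16.W q₁ q₂ a₁ a₂ a₅ with hw5d
    have plu : w * (S16.F a₁ q₁ - S16.F a₂ q₁) - w2 * (S16.F a₁ q₁ - S16.F a₅ q₁)
        = w5 * (S16.F a₁ q₁ - S16.F a₄ q₁) := by
      rw [hwd, hw2d, hw5d]; unfold S16.W; ring
    unfold S16.W at hwd hw2d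
    generalize S16.F a₁ q₁ = u1 at *
    generalize S16.F a₂ q₁ = u2 at *
    generalize S16.F a₄ q₁ = u4 at *
    generalize S16.F a₅ q₁ = u5 at *
    generalize S16.F a₁ q₂ = v1 at *
    generalize S16.F a₂ q₂ = v2 at *
    generalize S16.F a₄ q₂ = v4 at *
    generalize S16.F a₅ q₂ = v5 at *
    have d12 : 0 < u1 - u2 := by linarith
    obtain ⟨t, ht⟩ : ∃ t, t = w2 / (w * (u1 - u2)) := ⟨_, rfl⟩
    have ht0 : 0 < t := by
      rw [ht, ← div_div]
      apply div_pos _ d12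
      rw [show w2 / w = (w * w2) / w ^ 2 by field_simp]
      positivity
    have htw : t * w * (u1 - u2) = w2 := by rw [ht]; field_simp
    have hw2 : 0 < w ^ 2 := by positivity
    have ht1 : 0 < 1 - t * (u1 - u5) := by
      have : w ^ 2 * (u1 - u2) * (1 - t * (u1 - u5)) = (w5 * w) * (u1 - u4) := by
        linear_combination w * plu - w * (u1 - u5) * htw
      have h' : 0 < w ^ 2 * (u1 - u2) * (1 - t * (u1 - u5)) := by
        rw [this]; exact mul_pos sgB (by linarith)
      exact (mul_pos_iff_of_pos_left (by positivity)).1 h'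
    have E1 : u1 - u4 = lam₂ * (u1 - u2) := by linear_combination -hp4 - u1 * hsum
    have E2 : u4 - u2 = lam₁ * (u1 - u2) := by linear_combination hp4 + u2 * hsum
    have Q2 : t * (u4 - u5) * v1 + (1 - t * (u1 - u5)) * v4 + t * (u1 - u4) * v5
        = lam₁ * v1 + lam₂ * v2 := by
      apply mul_left_cancel₀ d12.ne'
      linear_combination (u1 - u2) * t * hwd - htw - hw2d - (v4 - v2) * E1 + (v1 - v4) * E2
        - (u1 - u2) * v4 * hsum
    refine ⟨(t * (u4 - u5), 1 - t * (u1 - u5), t * (u1 - u4)), ⟨⟨?_, ht1, ?_, ?_⟩, ?_, ?_⟩, ?_⟩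
    · exact mul_pos ht0 (by linarith)
    · exact mul_pos ht0 (by linarith)
    · simp only; ring
    · simp only; rw [← hp4]; ring
    · exact Q2
    · rintro L ⟨⟨_, _, _, hLs⟩, f1, f2⟩
      apply uniq L _ hLs (by simp only; ring)
      · simp only; rw [f1, ← hp4]; ring
      · simp only; rw [f2, ← Q2]
  · intro L hL e1 e2
    rw [cl3] at e1 e2
    obtain ⟨l1, l4, l5, hs⟩ := hL
    have hD : ∀ q, S16.D4 L.2.2 (-lam₂) L.2.1 (L.1 - lam₁) a₅ a₂ a₄ a₁ q =
      (L.1 * S16.F a₁ q + L.2.1 * S16.F a₄ q + L.2.2 * S16.F a₅ q)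
        - (lam₁ * S16.F a₁ q + lam₂ * S16.F a₂ q) := by
      intro q; unfold S16.D4; ring
    have z1 : S16.D4 L.2.2 (-lam₂) L.2.1 (L.1 - lam₁) a₅ a₂ a₄ a₁ q₁ = 0 := by
      rw [hD]; linarith
    have z2 : S16.D4 L.2.2 (-lam₂) L.2.1 (L.1 - lam₁) a₅ a₂ a₄ a₁ q₂ = 0 := by
      rw [hD]; linarith
    have hc : L.2.2 + (-lam₂) + L.2.1 + (L.1 - lam₁) = 0 := by linarith
    have hder : ∀ q, q = q₁ ∨ q = q₂ →
        deriv (fun q => L.1 * (S16.F a₁ q / Real.log 2) + L.2.1 * (S16.F a₄ q / Real.log 2)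
          + L.2.2 * (S16.F a₅ q / Real.log 2)) q
        ≠ deriv (fun q => lam₁ * (S16.F a₁ q / Real.log 2)
          + lam₂ * (S16.F a₂ q / Real.log 2)) q := by
      intro q hq hd
      have f1 := S16.hF a₁ q
      have f2 := S16.hF a₂ q
      have f4 := S16.hF a₄ q
      have f5 := S16.hF a₅ q
      have k1 := (((f1.div_const (Real.log 2)).const_mul L.1).add
        ((f4.div_const (Real.log 2)).const_mul L.2.1)).add
        ((f5.div_const (Real.log 2)).const_mul L.2.2)
      have k2 := ((f1.div_const (Real.log 2)).const_mul lam₁).add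
        ((f2.div_const (Real.log 2)).const_mul lam₂)
      have k3 := hd.symm.trans k1.deriv
      have k4 := k2.deriv.symm.trans k3
      have k5 := (((f5.const_mul L.2.2).add (f2.const_mul (-lam₂))).add
        (f4.const_mul L.2.1)).add (f1.const_mul (L.1 - lam₁))
      have k6 : HasDerivAt (S16.D4 L.2.2 (-lam₂) L.2.1 (L.1 - lam₁) a₅ a₂ a₄ a₁) 0 q := by
        refine HasDerivAt.congr_deriv (f := S16.D4 L.2.2 (-lam₂) L.2.1 (L.1 - lam₁) a₅ a₂ a₄ a₁)
          k5 ?_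
        clear k1 k2 k3 k5 f1 f2 f4 f5 hd
        generalize (a₁ * (-1 / (1 + Real.exp (a₁ * q))) - S16.g a₁) = d1 at *
        generalize (a₂ * (-1 / (1 + Real.exp (a₂ * q))) - S16.g a₂) = d2 at *
        generalize (a₄ * (-1 / (1 + Real.exp (a₄ * q))) - S16.g a₄) = d4 at *
        generalize (a₅ * (-1 / (1 + Real.exp (a₅ * q))) - S16.g a₅) = d5 at *
        simp only [mul_div_assoc', ← add_div] at k4
        rw [div_left_inj' hl2] at k4
        linarith
      have := S16.C4d s5 s52 s24 s41 hq₁ hq₁₂ hc z1 z2 hq k6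
      linarith [this.1]
    refine ⟨hder q₁ (Or.inl rfl), hder q₂ (Or.inr rfl), ?_⟩
    intro q hq n1 n2 he
    rw [cl3] at he
    have z3 : S16.D4 L.2.2 (-lam₂) L.2.1 (L.1 - lam₁) a₅ a₂ a₄ a₁ q = 0 := by
      rw [hD]; linarith
    have : L.2.2 = 0 := by
      rcases lt_or_gt_of_ne n1 with g1 | g1
      · exact (S16.C4 s5 s52 s24 s41 hq g1 hq₁₂ hc z3 z1 z2).1
      · rcases lt_or_gt_of_ne n2 with g2 | g2
        · exact (S16.C4 s5 s52 s24 s41 hq₁ g1 g2 hc z1 z3 z2).1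
        · exact (S16.C4 s5 s52 s24 s41 hq₁ hq₁₂ g2 hc z1 z2 z3).1
    linarith
end

section
/- Let n ≥ 2, let 0 < p₁ < p₂ < … < p_n < 1/2 and let τ = ∑_{i=1}^n λ_i·τ(p_i,·) be a convex combination (λ_i > 0, ∑λ_i = 1). Then for any 1 < q₁ < q₂ < +∞ there exist m ∈ ℕ, weights p'_1,…,p'_m ∈ (0,1/2) and a convex combination τ̃ = ∑_{j=1}^m μ_j·τ(p'_j,·) (μ_j ≥ 0, ∑μ_j = 1) such that τ̃(q_i) = τ(q_i) and τ̃'(q_i) ≠ τ'(q_i) for i = 1,2, and τ̃(q) ≠ τ(q) for every q ∈ (1,∞) with q ∉ {q₁, q₂}. -/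
open MeasureTheory Filter Set
open scoped Topology ENNReal NNReal Classical

noncomputable def th (y : ℝ) : ℝ := Real.sinh y / Real.cosh y

lemma th_deriv (y : ℝ) : HasDerivAt th (1 - th y ^ 2) y := by
  have h := (Real.hasDerivAt_sinh y).div (Real.hasDerivAt_cosh y) (Real.cosh_pos y).ne'
  refine h.congr_deriv ?_
  have := (Real.cosh_pos y).ne'
  unfold th
  field_simp

lemma th_sg (y : ℝ) : 1 - th y ^ 2 = 1 / Real.cosh y ^ 2 := by
  have := (Real.cosh_pos y).ne'
  have h2 := Real.cosh_sq y
  unfold th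
  field_simp
  linarith

lemma sg_pos (y : ℝ) : 0 < 1 - th y ^ 2 := by
  rw [th_sg]; have := Real.cosh_pos y; positivity

lemma th_pos {y : ℝ} (hy : 0 < y) : 0 < th y :=
  div_pos (Real.sinh_pos_iff.2 hy) (Real.cosh_pos y)

lemma th_lt_one (y : ℝ) : th y < 1 := by
  have := sg_pos y
  nlinarith [sq_nonneg (th y - 1)]

lemma th_strictMono : StrictMono th :=
  strictMono_of_hasDerivAt_pos th_deriv sg_pos

lemma th_zero : th 0 = 0 := by simp [th]

lemma th_le {y : ℝ} (hy : 0 ≤ y) : th y ≤ y := by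
  have h : Monotone (fun y => y - th y) := by
    apply monotone_of_hasDerivAt_nonneg (f' := fun y => 1 - (1 - th y ^ 2))
    · intro x; exact (hasDerivAt_id x).sub (th_deriv x)
    · intro x; simp; positivity
  have := h hy
  simp [th_zero] at this
  linarith

lemma ysg1 {y : ℝ} (hy : 0 ≤ y) : y ^ 2 * (1 - th y ^ 2) ≤ th y ^ 2 := by
  rw [th_sg]
  unfold th
  rw [div_pow, mul_one_div]
  have := Real.self_le_sinh_iff.2 hy
  gcongr

lemma cosh_ge (y : ℝ) : 1 + y ^ 2 / 2 ≤ Real.cosh y := by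
  have h := Real.cosh_two_mul (y/2)
  have h3 := Real.cosh_sq (y/2)
  rw [show 2 * (y/2) = y by ring] at h
  have h2 : (y/2)^2 ≤ Real.sinh (y/2)^2 := by
    rcases le_total 0 (y/2) with h | h
    · exact pow_le_pow_left₀ h (Real.self_le_sinh_iff.2 h) 2
    · have := Real.sinh_le_self_iff.2 h
      nlinarith
  nlinarith

lemma ysg2 (y : ℝ) : y ^ 2 * (1 - th y ^ 2) ≤ 1 / 2 := by
  rw [th_sg, mul_one_div, div_le_div_iff₀ (by have := Real.cosh_pos y; positivity) (by norm_num)]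
  have := cosh_ge y
  nlinarith [sq_nonneg (1 - y^2/2), sq_nonneg y]

noncomputable def nf (y : ℝ) : ℝ := y * th y
noncomputable def nd (y : ℝ) : ℝ := th y + y * (1 - th y ^ 2)

lemma nf_deriv (y : ℝ) : HasDerivAt nf (nd y) y := by
  have h := (hasDerivAt_id y).mul (th_deriv y)
  refine h.congr_deriv ?_
  simp [nd]

lemma nd_deriv (y : ℝ) : HasDerivAt nd (2 * (1 - th y ^ 2) * (1 - y * th y)) y := by
  have h := (th_deriv y).add ((hasDerivAt_id y).mul (((th_deriv y).pow 2).const_sub 1))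
  refine h.congr_deriv ?_
  simp
  ring

lemma nd_pos {y : ℝ} (hy : 0 < y) : 0 < nd y := by
  have := th_pos hy
  have := sg_pos y
  unfold nd; positivity

lemma key_ineq {y : ℝ} (hy : 0 < y) :
    nd y - y * (2 * (1 - th y ^ 2) * (1 - y * th y)) ≤ 5 / 2 * nd y ^ 3 := by
  have h1 := ysg1 hy.le
  have h2 := ysg2 y
  have h3 := th_le hy.le
  have h4 := th_pos hy
  have h5 := sg_pos y
  unfold nd
  set t := th y
  have hz : t * (1 - t^2) ≤ y * (1 - t^2) := by gcongr
  have hR : (t + t * (1 - t^2))^3 ≤ (t + y * (1 - t^2))^3 := by gcongr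
  have hL1 : (t + y * (1 - t^2)) - y * (2 * (1 - t ^ 2) * (1 - y * t)) ≤ 3 * t^3 := by
    nlinarith [mul_le_mul_of_nonneg_left h1 h4.le]
  have hL2 : (t + y * (1 - t^2)) - y * (2 * (1 - t ^ 2) * (1 - y * t)) ≤ t * (1 + t^2) := by
    nlinarith [mul_le_mul_of_nonneg_left h2 h4.le]
  have e : (t + t * (1 - t^2))^3 = t^3 * (2 - t^2)^3 := by ring
  have hu : 0 < t^2 := by positivity
  by_cases hc : t^2 ≤ 1/2
  · have : (3/2:ℝ)^3 ≤ (2 - t^2)^3 := by gcongr; linarith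
    have h6 : 3 * t^3 ≤ 5/2 * (t^3 * (2 - t^2)^3) := by
      have : 0 < t^3 := by positivity
      nlinarith
    linarith
  · push Not at hc
    have h7 : 1 + t^2 ≤ 5/2 * (t^2 * (2 - t^2)^3) := by
      generalize t^2 = u at *
      have : 1 + 3 * (1 - u) ≤ (2 - u)^3 := by nlinarith [mul_nonneg h5.le h5.le, mul_nonneg (mul_nonneg h5.le h5.le) h5.le]
      nlinarith [mul_le_mul_of_nonneg_left this hu.le]
    have h8 : t * (1 + t^2) ≤ t * (5/2 * (t^2 * (2 - t^2)^3)) := by gcongr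
    nlinarith

noncomputable def Kf (y : ℝ) : ℝ := y / nd y - 5 / 2 * nf y

lemma Kf_anti : AntitoneOn Kf (Set.Ioi 0) := by
  have hd : ∀ y : ℝ, 0 < y → HasDerivAt Kf
      ((1 * nd y - y * (2 * (1 - th y ^ 2) * (1 - y * th y))) / nd y ^ 2 - 5 / 2 * nd y) y := by
    intro y hy
    exact ((hasDerivAt_id y).div (nd_deriv y) (nd_pos hy).ne').sub ((nf_deriv y).const_mul _)
  apply antitoneOn_of_deriv_nonpos (convex_Ioi 0)
  · intro y hy; exact (hd y hy).continuousAt.continuousWithinAt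
  · intro y hy; rw [interior_Ioi] at hy; exact (hd y hy).differentiableAt.differentiableWithinAt
  · intro y hy; rw [interior_Ioi] at hy; rw [(hd y hy).deriv]
    have h := key_ineq hy
    have h2 := nd_pos hy
    rw [sub_nonpos, div_le_iff₀ (by positivity)]
    nlinarith

lemma nf_strict : StrictMonoOn nf (Set.Ici 0) := by
  apply strictMonoOn_of_deriv_pos (convex_Ici 0)
  · intro y hy; exact (nf_deriv y).continuousAt.continuousWithinAt
  · intro y hy; rw [interior_Ici] at hy; rw [(nf_deriv y).deriv]; exact nd_pos hy

lemma slope_eq {A B : ℝ} (hA : 0 < A) (hAB : A < B) : ∃ y ∈ Set.Ioo A B,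
    (B ^ 2 * (1 - th B ^ 2) - A ^ 2 * (1 - th A ^ 2)) / (nf B - nf A)
      = 2 * Kf y + 3 / 2 * (nf A + nf B) := by
  have hf : ∀ y, HasDerivAt (fun y => y ^ 2 - 5 / 2 * nf y ^ 2) (2 * y - 5 / 2 * (2 * nf y * nd y)) y := by
    intro y
    refine ((hasDerivAt_pow 2 y).sub (((nf_deriv y).pow 2).const_mul (5/2))).congr_deriv ?_
    simp
  obtain ⟨y, hy, h⟩ := exists_ratio_hasDerivAt_eq_ratio_slope _ _ hAB
    (fun x _ => (hf x).continuousAt.continuousWithinAt) (fun x _ => hf x) _ _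
    (fun x _ => (nf_deriv x).continuousAt.continuousWithinAt) (fun x _ => nf_deriv x)
  refine ⟨y, hy, ?_⟩
  have h1 : 0 < nf B - nf A := sub_pos.2 (nf_strict hA.le (hA.trans hAB).le hAB)
  have h2 := nd_pos (hA.trans hy.1)
  rw [div_eq_iff h1.ne']
  have h3 : (nf B - nf A) * (2 * Kf y) = (B ^ 2 - 5 / 2 * nf B ^ 2) - (A ^ 2 - 5 / 2 * nf A ^ 2) := by
    apply mul_right_cancel₀ h2.ne'
    rw [← h, Kf]
    field_simp
  have e1 : B ^ 2 * (1 - th B ^ 2) = B ^ 2 - nf B ^ 2 := by unfold nf; ring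
  have e2 : A ^ 2 * (1 - th A ^ 2) = A ^ 2 - nf A ^ 2 := by unfold nf; ring
  rw [e1, e2]
  linear_combination -h3

lemma concave_ineq {A B C : ℝ} (hA : 0 < A) (hAB : A < B) (hBC : B < C) :
    -(3 / 2) * (nf C - nf A) ≤
    (B ^ 2 * (1 - th B ^ 2) - A ^ 2 * (1 - th A ^ 2)) / (nf B - nf A) -
    (C ^ 2 * (1 - th C ^ 2) - B ^ 2 * (1 - th B ^ 2)) / (nf C - nf B) := by
  obtain ⟨y, hy, h⟩ := slope_eq hA hAB
  obtain ⟨z, hz, h'⟩ := slope_eq (hA.trans hAB) hBC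
  rw [h, h']
  have := Kf_anti (hA.trans hy.1) ((hA.trans hAB).trans hz.1) (hy.2.trans hz.1).le
  linarith

/- T s x = s tanh (s x) -/
noncomputable def Tf (s x : ℝ) : ℝ := s * th (s * x)

lemma Tf_deriv (s x : ℝ) : HasDerivAt (Tf s) (s ^ 2 * (1 - th (s * x) ^ 2)) x := by
  have h := ((th_deriv (s * x)).comp x ((hasDerivAt_id x).const_mul s)).const_mul s
  refine h.congr_deriv ?_
  simp; ring

lemma Tf_lt {s r x : ℝ} (hs : 0 < s) (hsr : s < r) (hx : 0 < x) : Tf s x < Tf r x := by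
  unfold Tf
  have : th (s * x) < th (r * x) := th_strictMono (by gcongr)
  have := th_pos (mul_pos hs hx)
  nlinarith

lemma cosh2_deriv (s x : ℝ) : HasDerivAt (fun x => Real.cosh (s * x) ^ 2)
    (2 * Real.cosh (s * x) ^ 2 * Tf s x) x := by
  have h := (((Real.hasDerivAt_cosh (s * x)).comp x ((hasDerivAt_id x).const_mul s))).pow 2
  refine h.congr_deriv ?_
  have := (Real.cosh_pos (s * x)).ne'
  simp [Tf, th]
  field_simp

/- ratio of cosh squares -/
noncomputable def uf (r s x : ℝ) : ℝ := Real.cosh (r * x) ^ 2 / Real.cosh (s * x) ^ 2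

lemma uf_pos (r s x : ℝ) : 0 < uf r s x := by
  unfold uf; have := Real.cosh_pos (r*x); have := Real.cosh_pos (s*x); positivity

lemma uf_deriv (r s x : ℝ) : HasDerivAt (uf r s) (2 * uf r s x * (Tf r x - Tf s x)) x := by
  have h0 := (Real.cosh_pos (s * x)).ne'
  refine ((cosh2_deriv r x).div (cosh2_deriv s x) (by positivity)).congr_deriv ?_
  unfold uf
  field_simp

noncomputable def Xf (r b s x : ℝ) : ℝ := uf b s x * ((Tf s x - Tf r x) / (Tf b x - Tf r x))

noncomputable def sl (s r x : ℝ) : ℝ :=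
  (s ^ 2 * (1 - th (s * x) ^ 2) - r ^ 2 * (1 - th (r * x) ^ 2)) / (Tf s x - Tf r x)

lemma Xf_deriv {r b s x : ℝ} (h : Tf b x - Tf r x ≠ 0) (h' : Tf s x - Tf r x ≠ 0) :
    HasDerivAt (Xf r b s)
      (Xf r b s x * (2 * (Tf b x - Tf s x) + sl s r x - sl b r x)) x := by
  refine ((uf_deriv b s x).mul (((Tf_deriv s x).sub (Tf_deriv r x)).div
    ((Tf_deriv b x).sub (Tf_deriv r x)) h)).congr_deriv ?_
  unfold Xf sl
  simp only [Pi.sub_apply, Pi.div_apply]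
  field_simp
  ring

lemma nf_eq (s x : ℝ) : nf (s * x) = x * Tf s x := by unfold nf Tf; ring

lemma sl_eq {s r x : ℝ} (hx : 0 < x) : ((s*x) ^ 2 * (1 - th (s*x) ^ 2) - (r*x) ^ 2 * (1 - th (r*x) ^ 2)) / (nf (s*x) - nf (r*x)) = x * sl s r x := by
  rw [nf_eq, nf_eq, sl, ← mul_sub, mul_pow, mul_pow, ← mul_div_assoc]
  rw [show s^2*x^2*(1 - th (s*x) ^ 2) - r^2*x^2*(1 - th (r*x) ^ 2) = x * (x * (s ^ 2 * (1 - th (s * x) ^ 2) - r ^ 2 * (1 - th (r * x) ^ 2))) by ring]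
  rw [mul_div_mul_left _ _ hx.ne']

lemma sl_ineq {a r b x : ℝ} (ha : 0 < a) (har : a < r) (hrb : r < b) (hx : 0 < x) :
    -(3 / 2) * (Tf b x - Tf a x) ≤ sl r a x - sl b r x := by
  have h := concave_ineq (mul_pos ha hx) (mul_lt_mul_of_pos_right har hx) (mul_lt_mul_of_pos_right hrb hx)
  rw [sl_eq hx, sl_eq hx, nf_eq, nf_eq] at h
  nlinarith

lemma sl_comm (r s x : ℝ) : sl r s x = sl s r x := by
  unfold sl
  rw [← neg_div_neg_eq]; ring


noncomputable def phi (a q : ℝ) : ℝ :=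
  Real.log (1 + Real.exp (-(2 * a * q))) - q * Real.log (1 + Real.exp (-(2 * a)))

noncomputable def dphi (a q : ℝ) : ℝ :=
  -(2 * a) / (1 + Real.exp (2 * a * q)) - Real.log (1 + Real.exp (-(2 * a)))

noncomputable def Vf (y : ℝ) : ℝ :=
  2 * y / (1 + Real.exp (2 * y)) + Real.log (1 + Real.exp (-(2 * y)))

lemma phi_deriv (a q : ℝ) : HasDerivAt (phi a) (dphi a q) q := by
  have h1 : HasDerivAt (fun q => -(2 * a * q)) (-(2 * a)) q := by
    simpa using ((hasDerivAt_id q).const_mul (2 * a)).fun_neg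
  have h0 : (1 + Real.exp (-(2 * a * q))) ≠ 0 := by positivity
  refine (((h1.exp.const_add 1).log h0).sub ((hasDerivAt_id q).mul_const _)).congr_deriv ?_
  unfold dphi
  have := Real.exp_pos (2 * a * q)
  rw [Real.exp_neg]
  field_simp
  ring

lemma phi_one (a : ℝ) : phi a 1 = 0 := by simp [phi]

lemma euler (a q : ℝ) : q * dphi a q - phi a q = -Vf (a * q) := by
  unfold dphi phi Vf
  rw [show 2 * (a * q) = 2 * a * q by ring]
  ring

lemma Vf_deriv (y : ℝ) : HasDerivAt Vf (-y * (1 - th y ^ 2)) y := by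
  have h1 : HasDerivAt (fun q : ℝ => -(2 * q)) (-2) y := by
    simpa using ((hasDerivAt_id y).const_mul (2:ℝ)).fun_neg
  have h2 : HasDerivAt (fun q : ℝ => (2 * q)) 2 y := by
    simpa using ((hasDerivAt_id y).const_mul (2:ℝ))
  have h0 : (1 + Real.exp (-(2 * y))) ≠ 0 := by positivity
  have h3 : (1 + Real.exp ((2 * y))) ≠ 0 := by positivity
  refine ((h2.div (h2.exp.const_add 1) h3).add ((h1.exp.const_add 1).log h0)).congr_deriv ?_
  rw [th_sg, Real.cosh_eq]
  rw [show 2 * y = y + y by ring, Real.exp_neg, Real.exp_neg, Real.exp_add]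
  have := Real.exp_pos y
  field_simp
  ring

lemma Vf_zero : Vf 0 = Real.log 2 := by simp [Vf]; norm_num

lemma Vf_tendsto : Tendsto Vf atTop (𝓝 0) := by
  have h2 : Tendsto (fun y : ℝ => 2 * y) atTop atTop := tendsto_id.const_mul_atTop (by norm_num)
  have h1 : Tendsto (fun y : ℝ => Real.log (1 + Real.exp (-(2 * y)))) atTop (𝓝 0) := by
    have : Tendsto (fun y : ℝ => (1 + Real.exp (-(2 * y)))) atTop (𝓝 (1 + 0)) :=
      tendsto_const_nhds.add (Real.tendsto_exp_neg_atTop_nhds_zero.comp h2)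
    have h := this.log (by norm_num)
    simpa using h
  have h3 : Tendsto (fun y : ℝ => 2 * y / (1 + Real.exp (2 * y))) atTop (𝓝 0) := by
    have h4 := (Real.tendsto_pow_mul_exp_neg_atTop_nhds_zero 1).comp h2
    refine tendsto_of_tendsto_of_tendsto_of_le_of_le' tendsto_const_nhds h4 ?_ ?_
    · filter_upwards [eventually_ge_atTop 0] with y hy
      positivity
    · filter_upwards [eventually_ge_atTop 0] with y hy
      simp only [Function.comp, pow_one, Real.exp_neg, ← div_eq_mul_inv]
      gcongr
      linarith
  have h5 := h3.add h1
  rw [add_zero] at h5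
  exact h5

noncomputable def Pf (a : ℝ) : ℝ := 1 / (1 + Real.exp (2 * a))

lemma Pf_mem {a : ℝ} (ha : 0 < a) : Pf a ∈ Set.Ioo (0:ℝ) (1 / 2) := by
  have : 1 < Real.exp (2 * a) := Real.one_lt_exp_iff.2 (by linarith)
  unfold Pf
  constructor
  · positivity
  · apply one_div_lt_one_div_of_lt <;> linarith

lemma tauP_Pf (a q : ℝ) : tauP (Pf a) q = phi a q / Real.log 2 := by
  unfold tauP Real.logb
  congr 1
  have e1 : Pf a = Real.exp (-(2 * a) - Real.log (1 + Real.exp (-(2 * a)))) := by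
    rw [Real.exp_sub, Real.exp_log (by positivity), Pf, Real.exp_neg]
    have := Real.exp_pos (2 * a)
    field_simp
    ring
  have e2 : 1 - Pf a = Real.exp (- Real.log (1 + Real.exp (-(2 * a)))) := by
    rw [Real.exp_neg, Real.exp_log (by positivity), Pf, Real.exp_neg]
    have := Real.exp_pos (2 * a)
    field_simp
    ring
  rw [e2, e1, ← Real.exp_mul, ← Real.exp_mul]
  have e3 : Real.exp ((-(2 * a) - Real.log (1 + Real.exp (-(2 * a)))) * q) + Real.exp (-Real.log (1 + Real.exp (-(2 * a))) * q) = Real.exp (- (q * Real.log (1 + Real.exp (-(2 * a))))) * (1 + Real.exp (-(2 * a * q))) := by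
    rw [mul_add, ← Real.exp_add, mul_one, add_comm]
    congr 2 <;> ring
  rw [e3, Real.log_mul (by positivity) (by positivity), Real.log_exp, phi]
  ring

lemma Pf_surj {p : ℝ} (hp : p ∈ Set.Ioo (0:ℝ) (1 / 2)) : ∃ a, 0 < a ∧ Pf a = p := by
  obtain ⟨h0, h1⟩ := hp
  have h2 : 1 < (1 - p) / p := by rw [lt_div_iff₀ h0]; linarith
  refine ⟨Real.log ((1 - p) / p) / 2, by have := Real.log_pos h2; positivity, ?_⟩
  rw [Pf, mul_div_cancel₀ _ (by norm_num), Real.exp_log (by linarith)]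
  field_simp
  ring

lemma Pf_lt {a b : ℝ} (h : Pf a < Pf b) : b < a := by
  by_contra hc
  push Not at hc
  have : Pf b ≤ Pf a := by
    unfold Pf
    gcongr
  linarith

lemma phi_tendsto {q : ℝ} (hq : 0 < q) : Tendsto (fun R => phi R q) atTop (𝓝 0) := by
  have h1 : ∀ c : ℝ, 0 < c → Tendsto (fun R : ℝ => Real.log (1 + Real.exp (-(2 * R * c)))) atTop (𝓝 0) := by
    intro c hc
    have h2 : Tendsto (fun y : ℝ => 2 * y * c) atTop atTop :=
      (tendsto_id.const_mul_atTop (by norm_num)).atTop_mul_const hc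
    have : Tendsto (fun y : ℝ => (1 + Real.exp (-(2 * y * c)))) atTop (𝓝 (1 + 0)) :=
      tendsto_const_nhds.add (Real.tendsto_exp_neg_atTop_nhds_zero.comp h2)
    have h := this.log (by norm_num)
    simpa using h
  have h := (h1 q hq).sub ((h1 1 one_pos).const_mul q)
  simpa [phi] using h

section sums
variable {ι : Type*} [Fintype ι] (c s : ι → ℝ)

noncomputable def Gs (q : ℝ) : ℝ := ∑ k, c k * phi (s k) q
noncomputable def dGs (q : ℝ) : ℝ := ∑ k, c k * dphi (s k) q
noncomputable def ws (q : ℝ) : ℝ := ∑ k, c k * Vf (s k * q)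
noncomputable def Fs (q : ℝ) : ℝ := ∑ k, c k * s k ^ 2 * (1 - th (s k * q) ^ 2)

lemma Gs_deriv (q : ℝ) : HasDerivAt (Gs c s) (dGs c s q) q := by
  have := HasDerivAt.fun_sum (u := Finset.univ) (fun k _ => (phi_deriv (s k) q).const_mul (c k))
  exact this

lemma ws_deriv (q : ℝ) : HasDerivAt (ws c s) (-q * Fs c s q) q := by
  have := HasDerivAt.fun_sum (u := Finset.univ) (fun k _ => ((Vf_deriv (s k * q)).comp q
    ((hasDerivAt_id q).const_mul (s k))).const_mul (c k))
  refine this.congr_deriv ?_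
  rw [Fs, Finset.mul_sum]
  apply Finset.sum_congr rfl
  intro k _
  simp
  ring

lemma ws_eq (q : ℝ) : q * dGs c s q - Gs c s q = -ws c s q := by
  unfold dGs Gs ws
  rw [Finset.mul_sum, ← Finset.sum_sub_distrib, ← Finset.sum_neg_distrib]
  apply Finset.sum_congr rfl
  intro k _
  linear_combination c k * euler (s k) q

lemma Gs_one : Gs c s 1 = 0 := by simp [Gs, phi_one]

lemma ws_tendsto (hs : ∀ k, 0 < s k) : Tendsto (ws c s) atTop (𝓝 0) := by
  have : Tendsto (ws c s) atTop (𝓝 (∑ k : ι, c k * 0)) := by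
    apply tendsto_finsetSum
    intro k _
    exact (Vf_tendsto.comp (tendsto_id.const_mul_atTop (hs k))).const_mul _
  simpa using this

lemma rolle1 {u v : ℝ} (hu : 0 < u) (huv : u < v) (h1 : Gs c s u = 0) (h2 : Gs c s v = 0) :
    ∃ z ∈ Set.Ioo u v, ws c s z = 0 := by
  have hd : ∀ x : ℝ, 0 < x → HasDerivAt (fun x => Gs c s x / x) ((dGs c s x * x - Gs c s x * 1) / x ^ 2) x :=
    fun x hx => (Gs_deriv c s x).div (hasDerivAt_id x) hx.ne'
  obtain ⟨z, hz, h⟩ := exists_hasDerivAt_eq_zero huv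
    (fun x hx => (hd x (hu.trans_le hx.1)).continuousAt.continuousWithinAt)
    (by simp [h1, h2]) (fun x hx => hd x (hu.trans hx.1))
  refine ⟨z, hz, ?_⟩
  have hz0 := hu.trans hz.1
  have := ws_eq c s z
  rw [div_eq_zero_iff] at h
  rcases h with h | h
  · linarith
  · exact absurd h (by positivity)

lemma rolle2 {u v : ℝ} (hu : 0 < u) (huv : u < v) (h1 : ws c s u = 0) (h2 : ws c s v = 0) :
    ∃ z ∈ Set.Ioo u v, Fs c s z = 0 := by
  obtain ⟨z, hz, h⟩ := exists_hasDerivAt_eq_zero huv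
    (fun x hx => (ws_deriv c s x).continuousAt.continuousWithinAt)
    (by simp [h1, h2]) (fun x hx => ws_deriv c s x)
  refine ⟨z, hz, ?_⟩
  have hz0 := hu.trans hz.1
  rcases mul_eq_zero.1 h with h | h
  · linarith
  · exact h

lemma rolle_inf {f f' : ℝ → ℝ} {u : ℝ} (hf : ∀ x, HasDerivAt f (f' x) x) (hu : f u = 0)
    (hl : Tendsto f atTop (𝓝 0)) : ∃ y, u < y ∧ f' y = 0 := by
  by_contra hc
  push Not at hc
  have hcont : Continuous f := continuous_iff_continuousAt.2 fun x => (hf x).continuousAt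
  have hne : f (u + 1) ≠ 0 := by
    intro h
    obtain ⟨z, hz, h⟩ := exists_hasDerivAt_eq_zero (show u < u + 1 by linarith) hcont.continuousOn
      (by rw [hu, h]) (fun x _ => hf x)
    exact hc z hz.1 h
  have hev : ∀ᶠ y in atTop, |f y| < |f (u+1)| / 2 := by
    have := hl.abs
    rw [abs_zero] at this
    exact this.eventually_lt_const (by positivity)
  obtain ⟨y, hy, hy1⟩ := (hev.and (eventually_gt_atTop (u + 1))).exists
  -- the value f(u+1)/2 is attained on both sides
  have hm1 : f (u+1) / 2 ∈ f '' Set.Icc u (u+1) := by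
    apply (Set.uIcc_of_le (show u ≤ u + 1 by linarith)) ▸ intermediate_value_uIcc hcont.continuousOn
    rw [hu, Set.mem_uIcc]
    rcases le_total 0 (f (u+1)) with h | h
    · left; constructor <;> linarith
    · right; constructor <;> linarith
  have hm2 : f (u+1) / 2 ∈ f '' Set.Icc (u+1) y := by
    apply (Set.uIcc_of_le hy1.le) ▸ intermediate_value_uIcc hcont.continuousOn
    rw [Set.mem_uIcc]
    rcases le_total 0 (f (u+1)) with h | h
    · rw [abs_of_nonneg h] at hy
      have := (abs_lt.1 hy)
      right; constructor <;> linarith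
    · rw [abs_of_nonpos h] at hy
      have := (abs_lt.1 hy)
      left; constructor <;> linarith
  obtain ⟨x1, hx1, e1⟩ := hm1
  obtain ⟨x2, hx2, e2⟩ := hm2
  have h12 : x1 < x2 := by
    rcases (hx1.2.trans hx2.1).lt_or_eq with h | h
    · exact h
    · exfalso
      have : x1 = u + 1 := le_antisymm hx1.2 (h ▸ hx2.1)
      rw [this] at e1
      apply hne; linarith
  obtain ⟨z, hz, h⟩ := exists_hasDerivAt_eq_zero h12 hcont.continuousOn
      (by rw [e1, e2]) (fun x _ => hf x)
  exact hc z (hx1.1.trans_lt hz.1) h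

lemma rolle3 (hs : ∀ k, 0 < s k) {u : ℝ} (hu : 0 < u) (h1 : ws c s u = 0) :
    ∃ z, u < z ∧ Fs c s z = 0 := by
  obtain ⟨z, hz, h⟩ := rolle_inf (ws_deriv c s) h1 (ws_tendsto c s hs)
  refine ⟨z, hz, ?_⟩
  have hz0 := hu.trans hz
  rcases mul_eq_zero.1 h with h | h
  · linarith
  · exact h

end sums


noncomputable def Ph (da dr db dR a r b R x : ℝ) : ℝ :=
  dr + da * uf r a x + db * uf r b x + dR * uf r R x

noncomputable def Th (da db dR a r b R x : ℝ) : ℝ :=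
  db + da * Xf r b a x + dR * Xf r b R x

lemma uf_mul (r b s x : ℝ) : uf r s x = uf r b x * uf b s x := by
  unfold uf
  have := (Real.cosh_pos (b * x)).ne'
  field_simp

lemma Ph_deriv (da dr db dR a : ℝ) {r b : ℝ} (R : ℝ) {x : ℝ} (hr : 0 < r) (hrb : r < b) (hx : 0 < x) :
    HasDerivAt (Ph da dr db dR a r b R)
      (-(2 * uf r b x * (Tf b x - Tf r x)) * Th da db dR a r b R x) x := by
  refine (((((uf_deriv r a x).const_mul da).const_add dr).add ((uf_deriv r b x).const_mul db)).add
    ((uf_deriv r R x).const_mul dR)).congr_deriv ?_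
  have h := sub_pos.2 (Tf_lt hr hrb hx)
  unfold Th Xf
  rw [uf_mul r b a, uf_mul r b R]
  field_simp
  ring

lemma Fs_Ph (ca cr cb cR a r b R x : ℝ) :
    Fs ![ca, cr, cb, cR] ![a, r, b, R] x * Real.cosh (r * x) ^ 2 =
      Ph (ca * a ^ 2) (cr * r ^ 2) (cb * b ^ 2) (cR * R ^ 2) a r b R x := by
  unfold Fs Ph uf
  simp only [Fin.sum_univ_four, th_sg]
  simp
  have := (Real.cosh_pos (r * x)).ne'
  field_simp
  ring

lemma Th_rolle {ca cr cb cR a r b R y1 y2 : ℝ} (hr : 0 < r) (hrb : r < b) (h1 : 0 < y1) (h12 : y1 < y2)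
    (e1 : Fs ![ca, cr, cb, cR] ![a, r, b, R] y1 = 0) (e2 : Fs ![ca, cr, cb, cR] ![a, r, b, R] y2 = 0) :
    ∃ z ∈ Set.Ioo y1 y2, Th (ca * a ^ 2) (cb * b ^ 2) (cR * R ^ 2) a r b R z = 0 := by
  have p1 := Fs_Ph ca cr cb cR a r b R y1
  have p2 := Fs_Ph ca cr cb cR a r b R y2
  rw [e1, zero_mul] at p1
  rw [e2, zero_mul] at p2
  have hd := fun x (hx : 0 < x) => Ph_deriv (ca * a ^ 2) (cr * r ^ 2) (cb * b ^ 2) (cR * R ^ 2) a R hr hrb hx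
  obtain ⟨z, hz, h⟩ := exists_hasDerivAt_eq_zero h12
    (fun x hx => (hd x (h1.trans_le hx.1)).continuousAt.continuousWithinAt)
    (by rw [← p1, ← p2]) (fun x hx => hd x (h1.trans hx.1))
  refine ⟨z, hz, ?_⟩
  have h3 := sub_pos.2 (Tf_lt hr hrb (h1.trans hz.1))
  have h4 := uf_pos r b z
  rcases mul_eq_zero.1 h with h | h
  · have : 0 < 2 * uf r b z * (Tf b z - Tf r z) := by positivity
    linarith
  · exact h

lemma Xa_neg {a r b x : ℝ} (ha : 0 < a) (har : a < r) (hrb : r < b) (hx : 0 < x) : Xf r b a x < 0 := by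
  have h1 := Tf_lt ha har hx
  have h2 := Tf_lt (ha.trans har) hrb hx
  exact mul_neg_of_pos_of_neg (uf_pos _ _ _) (div_neg_of_neg_of_pos (by linarith) (by linarith))

/-- log-derivative bound -/
lemma Xa_rate {a r b x : ℝ} (ha : 0 < a) (har : a < r) (hrb : r < b) (hx : 0 < x) :
    1 / 2 * (Tf b x - Tf a x) ≤ 2 * (Tf b x - Tf a x) + sl a r x - sl b r x := by
  have := sl_ineq ha har hrb hx
  rw [sl_comm r a] at this
  linarith

lemma Xa_anti {a r b : ℝ} (ha : 0 < a) (har : a < r) (hrb : r < b) :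
    StrictAntiOn (Xf r b a) (Set.Ioi 0) := by
  have hd : ∀ x : ℝ, 0 < x → HasDerivAt (Xf r b a) _ x := fun x hx =>
    Xf_deriv (sub_pos.2 (Tf_lt (ha.trans har) hrb hx)).ne' (sub_neg.2 (Tf_lt ha har hx)).ne
  apply strictAntiOn_of_deriv_neg (convex_Ioi 0)
  · intro x hx; exact (hd x hx).continuousAt.continuousWithinAt
  · intro x hx; rw [interior_Ioi] at hx; rw [(hd x hx).deriv]
    have h1 := Xa_rate ha har hrb hx
    have h2 := Tf_lt ha (har.trans hrb) hx
    exact mul_neg_of_neg_of_pos (Xa_neg ha har hrb hx) (by linarith)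

/-- The limiting three-term system. -/
lemma limit_sys {ca cr cb a r b q₁ q₂ : ℝ} (ha : 0 < a) (har : a < r) (hrb : r < b) (hq₁ : 1 < q₁) (hq : q₁ < q₂)
    (h1 : ca * phi a q₁ + cr * phi r q₁ + cb * phi b q₁ = 0)
    (h2 : ca * phi a q₂ + cr * phi r q₂ + cb * phi b q₂ = 0) :
    (cr = 0 → ca = 0 ∧ cb = 0) ∧ (0 < cr → ca < 0 ∧ cb < 0 ∧ ca + cr + cb < 0) := by
  have hr := ha.trans har
  have hb := hr.trans hrb
  set c : Fin 4 → ℝ := ![ca, cr, cb, 0] with hc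
  set s : Fin 4 → ℝ := ![a, r, b, b] with hs
  have hspos : ∀ k, 0 < s k := by
    intro k; fin_cases k <;> simp [hs, ha, hr, hb]
  have g1 : Gs c s q₁ = 0 := by
    rw [Gs, Fin.sum_univ_four]; simpa [hc, hs] using h1
  have g2 : Gs c s q₂ = 0 := by
    rw [Gs, Fin.sum_univ_four]; simpa [hc, hs] using h2
  obtain ⟨z1, hz1, w1⟩ := rolle1 c s one_pos hq₁ (Gs_one c s) g1
  obtain ⟨z2, hz2, w2⟩ := rolle1 c s (one_pos.trans hq₁) hq g1 g2
  have hz1p : 0 < z1 := one_pos.trans hz1.1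
  have hz12 : z1 < z2 := hz1.2.trans hz2.1
  obtain ⟨y1, hy1, f1⟩ := rolle2 c s hz1p hz12 w1 w2
  obtain ⟨y2, hy2, f2⟩ := rolle3 c s hspos (hz1p.trans hz12) w2
  have hy1p : 0 < y1 := hz1p.trans hy1.1
  have hy12 : y1 < y2 := hy1.2.trans hy2
  obtain ⟨ξ, hξ, t⟩ := Th_rolle hr hrb hy1p hy12 f1 f2
  have hξp : 0 < ξ := hy1p.trans hξ.1
  have p1 := Fs_Ph ca cr cb 0 a r b b y1
  rw [f1, zero_mul] at p1
  have hX := Xa_neg ha har hrb hξp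
  have hu1 := uf_pos r a y1
  have hu2 := uf_pos r b y1
  have t' := t
  simp only [Ph, Th, zero_mul, add_zero] at p1 t'
  have ha2 : 0 < a ^ 2 := by positivity
  have hb2 : 0 < b ^ 2 := by positivity
  have hr2 : 0 < r ^ 2 := by positivity
  have e : cr * r ^ 2 + (ca * a^2) * (uf r a y1 + (- Xf r b a ξ) * uf r b y1) = 0 := by
    linear_combination (-1 : ℝ) * p1 - uf r b y1 * t'
  have hpos : 0 < uf r a y1 + (- Xf r b a ξ) * uf r b y1 :=
    add_pos hu1 (mul_pos (by linarith) hu2)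
  constructor
  · intro h0
    rw [h0, zero_mul, zero_add] at e
    have h3 : ca * a ^ 2 = 0 := by
      rcases mul_eq_zero.1 e with h | h
      · exact h
      · linarith
    rw [h3] at t'
    constructor
    · rcases mul_eq_zero.1 h3 with h | h
      · exact h
      · linarith
    · rcases mul_eq_zero.1 (show cb * b^2 = 0 by linarith) with h | h
      · exact h
      · linarith
  · intro h0
    have hcr : 0 < cr * r ^ 2 := by positivity
    have hda : ca * a^2 < 0 := by
      by_contra hcon
      push Not at hcon
      have := mul_nonneg hcon hpos.le
      linarith
    have hdb : cb * b^2 < 0 := by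
      have := mul_pos_of_neg_of_neg hda hX
      linarith
    refine ⟨?_, ?_, ?_⟩
    · by_contra! h; exact absurd (mul_nonneg h ha2.le) (not_le.2 hda)
    · by_contra! h; exact absurd (mul_nonneg h hb2.le) (not_le.2 hdb)
    -- Ph negative on (0,y1)
    have hPd := fun x (hx : 0 < x) => Ph_deriv (ca * a ^ 2) (cr * r ^ 2) (cb * b ^ 2) (0 * b ^ 2) a b hr hrb hx
    have hmono : StrictMonoOn (Ph (ca * a ^ 2) (cr * r ^ 2) (cb * b ^ 2) (0 * b ^ 2) a r b b) (Set.Ioc 0 y1) := by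
      apply strictMonoOn_of_deriv_pos (convex_Ioc 0 y1)
      · intro x hx; exact (hPd x hx.1).continuousAt.continuousWithinAt
      · intro x hx; rw [interior_Ioc] at hx; rw [(hPd x hx.1).deriv]
        have k1 := sub_pos.2 (Tf_lt hr hrb hx.1)
        have k2 := uf_pos r b x
        have k3 : Xf r b a ξ < Xf r b a x := Xa_anti ha har hrb hx.1 hξp (hx.2.trans hξ.1)
        have k4 : Th (ca * a ^ 2) (cb * b ^ 2) (0 * b ^ 2) a r b b x < 0 := by
          simp only [Th, zero_mul, add_zero]
          have := mul_lt_mul_of_neg_left k3 hda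
          linarith
        have k5 : 0 < 2 * uf r b x * (Tf b x - Tf r x) := by positivity
        rw [neg_mul]
        exact neg_pos.2 (mul_neg_of_pos_of_neg k5 k4)
    have hF : ∀ x, 0 < x → x < y1 → Fs c s x < 0 := by
      intro x hx hxy
      have k1 := hmono ⟨hx, hxy.le⟩ ⟨hy1p, le_rfl⟩ hxy
      rw [← Fs_Ph, ← Fs_Ph] at k1
      have f1' : Fs ![ca, cr, cb, 0] ![a, r, b, b] y1 = 0 := f1
      rw [f1', zero_mul] at k1
      by_contra hcon
      push Not at hcon
      have := mul_nonneg hcon (sq_nonneg (Real.cosh (r * x)))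
      linarith
    have hw : StrictMonoOn (ws c s) (Set.Icc 0 z1) := by
      apply strictMonoOn_of_deriv_pos (convex_Icc 0 z1)
      · intro x hx; exact (ws_deriv c s x).continuousAt.continuousWithinAt
      · intro x hx; rw [interior_Icc] at hx; rw [(ws_deriv c s x).deriv]
        have := hF x hx.1 (hx.2.trans hy1.1)
        exact mul_pos_of_neg_of_neg (neg_neg_of_pos hx.1) this
    have hw0 := hw ⟨le_rfl, hz1p.le⟩ ⟨hz1p.le, le_rfl⟩ hz1p
    rw [w1] at hw0
    have e0 : ws c s 0 = (ca + cr + cb) * Real.log 2 := by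
      rw [ws, Fin.sum_univ_four]; simp [hc, Vf_zero]; ring
    rw [e0] at hw0
    have := Real.log_pos (show (1:ℝ) < 2 by norm_num)
    by_contra hcon
    push Not at hcon
    have := mul_nonneg hcon this.le
    linarith

/-- Condition ensuring at most two zeros. -/
lemma no_three {ca cr cb cR a r b R : ℝ} (ha : 0 < a) (har : a < r) (hrb : r < b) (hbR : b < R)
    (hsmall : ∀ x, 1 < x → cR * R ^ 2 * (-(Xf r b R x * (2 * (Tf b x - Tf R x) + sl R r x - sl b r x)))
      < ca * a ^ 2 * (Xf r b a x * (2 * (Tf b x - Tf a x) + sl a r x - sl b r x)))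
    {z1 z2 z3 : ℝ} (h1 : 1 < z1) (h12 : z1 < z2) (h23 : z2 < z3)
    (w1 : ws ![ca, cr, cb, cR] ![a, r, b, R] z1 = 0)
    (w2 : ws ![ca, cr, cb, cR] ![a, r, b, R] z2 = 0)
    (w3 : ws ![ca, cr, cb, cR] ![a, r, b, R] z3 = 0) : False := by
  have hr := ha.trans har
  have hb := hr.trans hrb
  have hR := hb.trans hbR
  have hz1 := one_pos.trans h1
  have hspos : ∀ k, 0 < (![a, r, b, R] : Fin 4 → ℝ) k := by
    intro k; fin_cases k <;> simp [ha, hr, hb, hR]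
  obtain ⟨y1, hy1, f1⟩ := rolle2 _ _ hz1 h12 w1 w2
  obtain ⟨y2, hy2, f2⟩ := rolle2 _ _ (hz1.trans h12) h23 w2 w3
  obtain ⟨y3, hy3, f3⟩ := rolle3 _ _ hspos ((hz1.trans h12).trans h23) w3
  have hy1p := hz1.trans hy1.1
  have hy12 := hy1.2.trans hy2.1
  have hy23 := hy2.2.trans hy3
  obtain ⟨x1, hx1, t1⟩ := Th_rolle hr hrb hy1p hy12 f1 f2
  obtain ⟨x2, hx2, t2⟩ := Th_rolle hr hrb (hy1p.trans hy12) hy23 f2 f3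
  have hx1' : 1 < x1 := (h1.trans hy1.1).trans hx1.1
  have hd : ∀ x, 1 < x → HasDerivAt (Th (ca * a ^ 2) (cb * b ^ 2) (cR * R ^ 2) a r b R)
      (ca * a ^ 2 * (Xf r b a x * (2 * (Tf b x - Tf a x) + sl a r x - sl b r x)) +
       cR * R ^ 2 * (Xf r b R x * (2 * (Tf b x - Tf R x) + sl R r x - sl b r x))) x := by
    intro x hx
    have hx0 := one_pos.trans hx
    have k1 := (sub_pos.2 (Tf_lt hr hrb hx0)).ne'
    have k2 := (sub_pos.2 (Tf_lt hr (hrb.trans hbR) hx0)).ne'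
    have k3 := (sub_neg.2 (Tf_lt ha har hx0)).ne
    exact (((Xf_deriv k1 k3).const_mul _).const_add _).add ((Xf_deriv k1 k2).const_mul _)
  obtain ⟨x, hx, h⟩ := exists_hasDerivAt_eq_zero (hx1.2.trans hx2.1)
    (fun x hx => (hd x (hx1'.trans_le hx.1)).continuousAt.continuousWithinAt)
    (by rw [t1, t2]) (fun x hx => hd x (hx1'.trans hx.1))
  have := hsmall x (hx1'.trans hx.1)
  linarith


lemma Tf_gap {s r x : ℝ} (hs : 0 < s) (hsr : s < r) (hx : 1 < x) :
    (r - s) * th r ≤ Tf r x - Tf s x := by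
  have hr := hs.trans hsr
  unfold Tf
  have h1 : th (s * x) ≤ th (r * x) := th_strictMono.monotone (by nlinarith)
  have h2 : th r ≤ th (r * x) := th_strictMono.monotone (by nlinarith)
  have h3 : (r - s) * th r ≤ (r - s) * th (r * x) := mul_le_mul_of_nonneg_left h2 (by linarith)
  have h4 : s * th (s * x) ≤ s * th (r * x) := mul_le_mul_of_nonneg_left h1 hs.le
  linarith

lemma uf_small {a R x : ℝ} (ha : 0 < a) (haR : a < R) (hx : 1 < x) :
    uf a R x ≤ 4 * Real.exp a * Real.exp (-R) := by
  have h1 : Real.cosh (a * x) ≤ Real.exp (a * x) := by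
    rw [Real.cosh_eq]
    have : Real.exp (-(a * x)) ≤ Real.exp (a * x) := Real.exp_le_exp.2 (by nlinarith)
    linarith
  have h2 : Real.exp (R * x) / 2 ≤ Real.cosh (R * x) := by
    rw [Real.cosh_eq]
    have := Real.exp_pos (-(R * x))
    linarith
  have h3 : uf a R x ≤ Real.exp (a * x) ^ 2 / (Real.exp (R * x) / 2) ^ 2 := by
    unfold uf
    have := Real.cosh_pos (a * x)
    gcongr
  refine h3.trans ?_
  have h4 : Real.exp (a * x) ^ 2 / (Real.exp (R * x) / 2) ^ 2 = 4 * Real.exp (2 * (a * x) - 2 * (R * x)) := by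
    rw [Real.exp_sub, two_mul, two_mul, Real.exp_add, Real.exp_add]
    field_simp
    norm_num
  rw [h4, mul_assoc, ← Real.exp_add]
  gcongr
  nlinarith

lemma small_cond {ca cR a r b R : ℝ} (ha : 0 < a) (har : a < r) (hrb : r < b) (hbR : b < R)
    (hca : ca < 0) (hcR : 0 < cR)
    (hcond : cR * R ^ 2 * (4 * Real.exp a * Real.exp (-R)) * R *
        (2 * R + (b ^ 2 + r ^ 2) / ((b - r) * th b)) +
      ca * a ^ 2 * ((r - a) * th r) * (1 / 2 * ((b - a) * th b)) < 0) :
    ∀ x, 1 < x → cR * R ^ 2 * (-(Xf r b R x * (2 * (Tf b x - Tf R x) + sl R r x - sl b r x)))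
      < ca * a ^ 2 * (Xf r b a x * (2 * (Tf b x - Tf a x) + sl a r x - sl b r x)) := by
  intro x hx
  have hx0 := one_pos.trans hx
  have hr := ha.trans har
  have hb := hr.trans hrb
  have hR := hb.trans hbR
  have D0 : 0 < (b - r) * th b := mul_pos (by linarith) (th_pos hb)
  have g1 := Tf_gap hr hrb hx
  have g2 := Tf_gap ha har hx
  have g3 := Tf_gap ha (har.trans hrb) hx
  have g4 := Tf_lt hb hbR hx0
  have hTr : 0 < Tf r x := mul_pos hr (th_pos (mul_pos hr hx0))
  have hTb : 0 < Tf b x := mul_pos hb (th_pos (mul_pos hb hx0))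
  have hTR : Tf R x < R := by
    unfold Tf
    have := th_lt_one (R * x)
    nlinarith
  have P1 : 0 < (r - a) * th r := mul_pos (by linarith) (th_pos hr)
  have P2 : 0 < (b - a) * th b := mul_pos (by linarith) (th_pos hb)
  have hrate := Xa_rate ha har hrb hx0
  set rate := 2 * (Tf b x - Tf a x) + sl a r x - sl b r x
  have s1 : sl b r x ≤ b ^ 2 / ((b - r) * th b) := by
    unfold sl
    have k1 : 0 ≤ r ^ 2 * (1 - th (r * x) ^ 2) := mul_nonneg (sq_nonneg _) (sg_pos _).le
    have k2 : b ^ 2 * (1 - th (b * x) ^ 2) ≤ b ^ 2 := by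
      have := mul_nonneg (sq_nonneg b) (sq_nonneg (th (b * x)))
      linarith
    have := sq_nonneg b
    apply div_le_div₀ (sq_nonneg _) (by linarith) D0 g1
  have s2 : - sl R r x ≤ r ^ 2 / ((b - r) * th b) := by
    unfold sl
    rw [← neg_div]
    have k1 : 0 ≤ R ^ 2 * (1 - th (R * x) ^ 2) := mul_nonneg (sq_nonneg _) (sg_pos _).le
    have k2 : r ^ 2 * (1 - th (r * x) ^ 2) ≤ r ^ 2 := by
      have := mul_nonneg (sq_nonneg r) (sq_nonneg (th (r * x)))
      linarith
    apply div_le_div₀ (sq_nonneg _) (by linarith) D0 (by linarith)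
  have s3 : -(2 * (Tf b x - Tf R x) + sl R r x - sl b r x) ≤
      2 * R + (b ^ 2 + r ^ 2) / ((b - r) * th b) := by
    rw [add_div]
    linarith
  set br := 2 * (Tf b x - Tf R x) + sl R r x - sl b r x
  set B := 2 * R + (b ^ 2 + r ^ 2) / ((b - r) * th b) with hB
  have hBpos : 0 < B := by positivity
  have hu := uf_small ha (har.trans (hrb.trans hbR)) hx
  have hup := uf_pos a R x
  have hQ : 0 < Tf b x - Tf r x := by linarith
  -- reduced inequality
  have main : cR * R ^ 2 * uf a R x * (Tf R x - Tf r x) * (-br) +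
      ca * a ^ 2 * (Tf r x - Tf a x) * rate < 0 := by
    have m1 : cR * R ^ 2 * uf a R x * (Tf R x - Tf r x) * (-br) ≤
        cR * R ^ 2 * (4 * Real.exp a * Real.exp (-R)) * R * B := by
      have k0 : 0 < Tf R x - Tf r x := by linarith
      have k1 : cR * R ^ 2 * uf a R x * (Tf R x - Tf r x) * (-br) ≤
        cR * R ^ 2 * uf a R x * (Tf R x - Tf r x) * B := by gcongr
      refine k1.trans ?_
      gcongr
      linarith
    have m2 : (-ca) * a ^ 2 * ((r - a) * th r) * (1 / 2 * ((b - a) * th b)) ≤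
        (-ca) * a ^ 2 * (Tf r x - Tf a x) * rate := by
      have : 0 < -ca := by linarith
      have : 0 < Tf r x - Tf a x := by linarith
      gcongr
      linarith
    linarith
  have e : cR * R ^ 2 * (-(Xf r b R x * br)) - ca * a ^ 2 * (Xf r b a x * rate) =
      uf b a x / (Tf b x - Tf r x) * (cR * R ^ 2 * uf a R x * (Tf R x - Tf r x) * (-br) +
      ca * a ^ 2 * (Tf r x - Tf a x) * rate) := by
    unfold Xf
    rw [uf_mul b a R]
    field_simp
    ring
  have := mul_neg_of_pos_of_neg (div_pos (uf_pos b a x) hQ) main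
  linarith

lemma exists_coeffs {a b q₁ q₂ : ℝ} (ha : 0 < a) (hab : a < b) (hq₁ : 1 < q₁) (hq : q₁ < q₂) :
    ∃ r R ca cr cb cR : ℝ, 0 < r ∧ 0 < R ∧ 0 < cr ∧ 0 < cR ∧ ca + cr + cb + cR = 0 ∧
      Gs ![ca, cr, cb, cR] ![a, r, b, R] q₁ = 0 ∧ Gs ![ca, cr, cb, cR] ![a, r, b, R] q₂ = 0 ∧
      dGs ![ca, cr, cb, cR] ![a, r, b, R] q₁ ≠ 0 ∧ dGs ![ca, cr, cb, cR] ![a, r, b, R] q₂ ≠ 0 ∧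
      ∀ q, 1 < q → q ≠ q₁ → q ≠ q₂ → Gs ![ca, cr, cb, cR] ![a, r, b, R] q ≠ 0 := by
  obtain ⟨r, har, hrb⟩ := exists_between hab
  have hr := ha.trans har
  have hb := hr.trans hrb
  have hq₁0 : 0 < q₁ := by linarith
  have hq₂0 : 0 < q₂ := by linarith
  have two := fun ca cb h1 h2 => (limit_sys (ca := ca) (cr := 0) (cb := cb) ha har hrb hq₁ hq h1 h2).1 rfl
  have hΔ : phi a q₁ * phi b q₂ - phi a q₂ * phi b q₁ ≠ 0 := by
    intro h
    obtain ⟨h1, h2⟩ := two (phi b q₁) (-phi a q₁) (by ring) (by linear_combination -h)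
    obtain ⟨h3, h4⟩ := two (phi b q₂) (-phi a q₂) (by linear_combination h) (by ring)
    obtain ⟨h5, h6⟩ := two 1 0 (by linarith) (by linarith)
    exact one_ne_zero h5
  let Δ : ℝ → ℝ → ℝ := fun X Y => (phi a q₁ - X) * (phi b q₂ - Y) - (phi a q₂ - Y) * (phi b q₁ - X)
  let fa : ℝ → ℝ → ℝ := fun X Y => -((phi r q₁ - X) * (phi b q₂ - Y) - (phi r q₂ - Y) * (phi b q₁ - X)) / Δ X Y
  let fb : ℝ → ℝ → ℝ := fun X Y => -((phi a q₁ - X) * (phi r q₂ - Y) - (phi a q₂ - Y) * (phi r q₁ - X)) / Δ X Y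
  have hsol : ∀ X Y, Δ X Y ≠ 0 → fa X Y * (phi a q₁ - X) + fb X Y * (phi b q₁ - X) + (phi r q₁ - X) = 0 ∧
      fa X Y * (phi a q₂ - Y) + fb X Y * (phi b q₂ - Y) + (phi r q₂ - Y) = 0 := by
    intro X Y h
    simp only [fa, fb]
    constructor
    · field_simp
      simp only [Δ]; ring
    · field_simp
      simp only [Δ]; ring
  have hX := phi_tendsto hq₁0
  have hY := phi_tendsto hq₂0
  have tΔ : Tendsto (fun R => Δ (phi R q₁) (phi R q₂)) atTop (𝓝 (Δ 0 0)) :=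
    ((hX.const_sub _).mul (hY.const_sub _)).sub ((hY.const_sub _).mul (hX.const_sub _))
  have hΔ0 : Δ 0 0 ≠ 0 := by simpa [Δ] using hΔ
  have ta : Tendsto (fun R => fa (phi R q₁) (phi R q₂)) atTop (𝓝 (fa 0 0)) :=
    (((hX.const_sub _).mul (hY.const_sub _)).sub ((hY.const_sub _).mul (hX.const_sub _))).neg.div tΔ hΔ0
  have tb : Tendsto (fun R => fb (phi R q₁) (phi R q₂)) atTop (𝓝 (fb 0 0)) :=
    (((hX.const_sub _).mul (hY.const_sub _)).sub ((hY.const_sub _).mul (hX.const_sub _))).neg.div tΔ hΔ0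
  obtain ⟨s1, s2⟩ := hsol 0 0 hΔ0
  obtain ⟨na, nb, ns⟩ := (limit_sys (ca := fa 0 0) (cr := 1) (cb := fb 0 0) ha har hrb hq₁ hq
    (by linarith) (by linarith)).2 one_pos
  let cR : ℝ → ℝ := fun R => -(fa (phi R q₁) (phi R q₂) + 1 + fb (phi R q₁) (phi R q₂))
  have tR : Tendsto cR atTop (𝓝 (-(fa 0 0 + 1 + fb 0 0))) := ((ta.add_const 1).add tb).neg
  set B := (b ^ 2 + r ^ 2) / ((b - r) * th b) with hB
  have tsmall : Tendsto (fun R => cR R * R ^ 2 * (4 * Real.exp a * Real.exp (-R)) * R * (2 * R + B) +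
      fa (phi R q₁) (phi R q₂) * a ^ 2 * ((r - a) * th r) * (1 / 2 * ((b - a) * th b))) atTop
      (𝓝 (-(fa 0 0 + 1 + fb 0 0) * (4 * Real.exp a * (2 * 0 + B * 0)) +
        fa 0 0 * a ^ 2 * ((r - a) * th r) * (1 / 2 * ((b - a) * th b)))) := by
    have e4 := Real.tendsto_pow_mul_exp_neg_atTop_nhds_zero 4
    have e3 := Real.tendsto_pow_mul_exp_neg_atTop_nhds_zero 3
    have := (tR.mul (((e4.const_mul 2).add (e3.const_mul B)).const_mul (4 * Real.exp a))).add
      (((ta.mul_const (a ^ 2)).mul_const ((r - a) * th r)).mul_const (1 / 2 * ((b - a) * th b)))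
    refine this.congr ?_
    intro R
    ring
  have P1 : 0 < (r - a) * th r := mul_pos (by linarith) (th_pos hr)
  have P2 : 0 < (b - a) * th b := mul_pos (by linarith) (th_pos hb)
  have hneg : -(fa 0 0 + 1 + fb 0 0) * (4 * Real.exp a * (2 * 0 + B * 0)) +
        fa 0 0 * a ^ 2 * ((r - a) * th r) * (1 / 2 * ((b - a) * th b)) < 0 := by
    have : 0 < (-fa 0 0) * a ^ 2 * ((r - a) * th r) * (1 / 2 * ((b - a) * th b)) := by
      have : 0 < - fa 0 0 := by linarith
      positivity
    linarith
  obtain ⟨R, ⟨⟨⟨h1, h2⟩, h3⟩, h4⟩, h5⟩ := (((((tΔ.eventually_ne hΔ0).and (ta.eventually_lt_const na)).and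
    (tR.eventually_const_lt (show 0 < -(fa 0 0 + 1 + fb 0 0) by linarith))).and
    (tsmall.eventually_lt_const hneg)).and (eventually_gt_atTop b)).exists
  have hR := hb.trans h5
  obtain ⟨e1, e2⟩ := hsol _ _ h1
  set ca := fa (phi R q₁) (phi R q₂) with hcadef
  set cb := fb (phi R q₁) (phi R q₂) with hcbdef
  have hcR : cR R = -(ca + 1 + cb) := rfl
  have hno := @no_three ca 1 cb (cR R) a r b R ha har hrb h5 (small_cond ha har hrb h5 h2 h3 h4)
  have g1 : Gs ![ca, 1, cb, cR R] ![a, r, b, R] q₁ = 0 := by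
    rw [Gs, Fin.sum_univ_four]; simp; rw [hcR]; linarith
  have g2 : Gs ![ca, 1, cb, cR R] ![a, r, b, R] q₂ = 0 := by
    rw [Gs, Fin.sum_univ_four]; simp; rw [hcR]; linarith
  have g0 := Gs_one ![ca, 1, cb, cR R] ![a, r, b, R]
  generalize hc : ![ca, 1, cb, cR R] = c at *
  generalize hs : ![a, r, b, R] = s at *
  obtain ⟨z1, hz1, w1⟩ := rolle1 c s one_pos hq₁ g0 g1
  obtain ⟨z2, hz2, w2⟩ := rolle1 c s hq₁0 hq g1 g2
  refine ⟨r, R, ca, 1, cb, cR R, hr, hR, one_pos, h3, by rw [hcR]; ring, ?_⟩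
  rw [hc, hs]
  refine ⟨g1, g2, ?_, ?_, ?_⟩
  · intro h
    have hw := ws_eq c s q₁
    rw [h, g1] at hw
    exact hno hz1.1 hz1.2 hz2.1 w1 (by linarith) w2
  · intro h
    have hw := ws_eq c s q₂
    rw [h, g2] at hw
    exact hno hz1.1 (hz1.2.trans hz2.1) hz2.2 w1 w2 (by linarith)
  · intro q hq1 hne1 hne2 hg
    rcases lt_or_gt_of_ne hne1 with h | h
    · obtain ⟨x1, hx1, v1⟩ := rolle1 c s one_pos hq1 g0 hg
      obtain ⟨x2, hx2, v2⟩ := rolle1 c s (by linarith) h hg g1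
      exact hno hx1.1 (hx1.2.trans hx2.1) (hx2.2.trans hz2.1) v1 v2 w2
    · rcases lt_or_gt_of_ne hne2 with h' | h'
      · obtain ⟨x1, hx1, v1⟩ := rolle1 c s hq₁0 h g1 hg
        obtain ⟨x2, hx2, v2⟩ := rolle1 c s (by linarith) h' hg g2
        exact hno hz1.1 (hz1.2.trans hx1.1) (hx1.2.trans hx2.1) w1 v1 v2
      · obtain ⟨x2, hx2, v2⟩ := rolle1 c s hq₂0 h' g2 hg
        exact hno hz1.1 (hz1.2.trans hz2.1) (hz2.2.trans hx2.1) w1 w2 v2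

/-- **Lemma 4.5.** For any convex combination `τ = ∑ λᵢ τ(pᵢ,·)` (`n ≥ 2`,
`0 < p₁ < … < p_n < 1/2`, `λᵢ > 0`) and any `1 < q₁ < q₂`, there is another convex
combination `τ̃ = ∑ μⱼ τ(p'ⱼ,·)` with `τ̃(qᵢ) = τ(qᵢ)`, `τ̃'(qᵢ) ≠ τ'(qᵢ)` (`i = 1,2`)
and `τ̃(q) ≠ τ(q)` for all `q > 1` with `q ∉ {q₁, q₂}`. -/
theorem stmt17 (n : ℕ) (hn : 2 ≤ n) (p : Fin n → ℝ)
    (hp : ∀ i, p i ∈ Set.Ioo (0:ℝ) (1 / 2)) (hmono : StrictMono p)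
    (lam : Fin n → ℝ) (hlam : ∀ i, 0 < lam i) (hsum : ∑ i, lam i = 1)
    (q₁ q₂ : ℝ) (hq₁ : 1 < q₁) (hq₁₂ : q₁ < q₂) :
    ∃ (m : ℕ) (p' : Fin m → ℝ) (mu : Fin m → ℝ),
      (∀ j, p' j ∈ Set.Ioo (0:ℝ) (1 / 2)) ∧ (∀ j, 0 ≤ mu j) ∧ (∑ j, mu j = 1) ∧
      ((∑ j, mu j * tauP (p' j) q₁) = ∑ i, lam i * tauP (p i) q₁) ∧
      ((∑ j, mu j * tauP (p' j) q₂) = ∑ i, lam i * tauP (p i) q₂) ∧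
      (deriv (fun q => ∑ j, mu j * tauP (p' j) q) q₁
          ≠ deriv (fun q => ∑ i, lam i * tauP (p i) q) q₁) ∧
      (deriv (fun q => ∑ j, mu j * tauP (p' j) q) q₂
          ≠ deriv (fun q => ∑ i, lam i * tauP (p i) q) q₂) ∧
      ∀ q : ℝ, 1 < q → q ≠ q₁ → q ≠ q₂ →
        (∑ j, mu j * tauP (p' j) q) ≠ ∑ i, lam i * tauP (p i) q := by
  have hL : 0 < Real.log 2 := Real.log_pos (by norm_num)
  let i0 : Fin n := ⟨0, by omega⟩
  let i1 : Fin n := ⟨1, by omega⟩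
  have hi : i0 < i1 := by simp [i0, i1, Fin.lt_def]
  have hpl := hmono hi
  obtain ⟨a, ha, hPa⟩ := Pf_surj (hp i1)
  obtain ⟨b, hb, hPb⟩ := Pf_surj (hp i0)
  have hab : a < b := Pf_lt (by rw [hPa, hPb]; exact hpl)
  obtain ⟨r, R, ca, cr, cb, cR, hr, hR, hcr, hcR, hs0, g1, g2, d1, d2, hne⟩ :=
    exists_coeffs ha hab hq₁ hq₁₂
  -- small parameter
  obtain ⟨ε, hε, hε1, hε0⟩ : ∃ ε : ℝ, 0 < ε ∧ 0 ≤ lam i1 + ε * ca ∧ 0 ≤ lam i0 + ε * cb := by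
    have l0 := hlam i0
    have l1 := hlam i1
    have A := neg_abs_le ca
    have B := neg_abs_le cb
    have A0 := abs_nonneg ca
    have B0 := abs_nonneg cb
    have hm : 0 < min (lam i0) (lam i1) := lt_min l0 l1
    refine ⟨min (lam i0) (lam i1) / (1 + |ca| + |cb|), by positivity, ?_, ?_⟩
    · have h1 : min (lam i0) (lam i1) / (1 + |ca| + |cb|) * |ca| ≤ lam i1 := by
        rw [div_mul_eq_mul_div, div_le_iff₀ (by positivity)]
        have := min_le_right (lam i0) (lam i1)
        nlinarith
      have h2 : 0 < min (lam i0) (lam i1) / (1 + |ca| + |cb|) := by positivity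
      nlinarith
    · have h1 : min (lam i0) (lam i1) / (1 + |ca| + |cb|) * |cb| ≤ lam i0 := by
        rw [div_mul_eq_mul_div, div_le_iff₀ (by positivity)]
        have := min_le_left (lam i0) (lam i1)
        nlinarith
      have h2 : 0 < min (lam i0) (lam i1) / (1 + |ca| + |cb|) := by positivity
      nlinarith
  let nu : Fin n → ℝ := fun i => lam i + ((if i = i1 then ε * ca else 0) + (if i = i0 then ε * cb else 0))
  have hnusum : ∀ f : Fin n → ℝ, ∑ i, nu i * f i = ∑ i, lam i * f i + (ε * ca * f i1 + ε * cb * f i0) := by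
    intro f
    simp only [nu, add_mul, Finset.sum_add_distrib, ite_mul, zero_mul]
    simp
  let p' : Fin (n + 2) → ℝ := Fin.cons (Pf r) (Fin.cons (Pf R) p)
  let mu : Fin (n + 2) → ℝ := Fin.cons (ε * cr) (Fin.cons (ε * cR) nu)
  have hdiff : ∀ q, ∑ j, mu j * tauP (p' j) q = ∑ i, lam i * tauP (p i) q +
      ε / Real.log 2 * Gs ![ca, cr, cb, cR] ![a, r, b, R] q := by
    intro q
    rw [Fin.sum_univ_succ, Fin.sum_univ_succ]
    simp only [mu, p', Fin.cons_zero, Fin.cons_succ]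
    rw [hnusum (fun i => tauP (p i) q)]
    simp only [← hPa, ← hPb, tauP_Pf]
    rw [Gs, Fin.sum_univ_four]
    simp
    field_simp
    ring
  have hεL : ε / Real.log 2 ≠ 0 := by positivity
  have hτ : ∀ q, DifferentiableAt ℝ (fun q => ∑ i, lam i * tauP (p i) q) q := by
    intro q
    apply DifferentiableAt.fun_sum
    intro i _
    obtain ⟨s, hs, hPs⟩ := Pf_surj (hp i)
    have : (fun q => lam i * tauP (p i) q) = fun q => lam i * (phi s q / Real.log 2) := by
      funext q; rw [← hPs, tauP_Pf]
    rw [this]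
    exact (((phi_deriv s q).div_const _).const_mul _).differentiableAt
  have hder : ∀ q, deriv (fun q => ∑ j, mu j * tauP (p' j) q) q =
      deriv (fun q => ∑ i, lam i * tauP (p i) q) q +
      ε / Real.log 2 * dGs ![ca, cr, cb, cR] ![a, r, b, R] q := by
    intro q
    have : (fun q => ∑ j, mu j * tauP (p' j) q) = fun q => ∑ i, lam i * tauP (p i) q +
      ε / Real.log 2 * Gs ![ca, cr, cb, cR] ![a, r, b, R] q := funext hdiff
    rw [this]
    exact ((hτ q).hasDerivAt.add ((Gs_deriv _ _ q).const_mul _)).deriv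
  refine ⟨n + 2, p', mu, ?_, ?_, ?_, ?_, ?_, ?_, ?_, ?_⟩
  · intro j
    refine Fin.cases ?_ (fun j => Fin.cases ?_ (fun j => ?_) j) j
    · exact Pf_mem hr
    · exact Pf_mem hR
    · exact hp j
  · intro j
    refine Fin.cases ?_ (fun j => Fin.cases ?_ (fun j => ?_) j) j
    · exact (mul_pos hε hcr).le
    · exact (mul_pos hε hcR).le
    · change 0 ≤ nu j
      simp only [nu]
      by_cases h1 : j = i1
      · have : j ≠ i0 := by rw [h1]; exact hi.ne'
        rw [if_pos h1, if_neg this, h1]; linarith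
      · by_cases h0 : j = i0
        · rw [if_neg h1, if_pos h0, h0]; linarith
        · rw [if_neg h1, if_neg h0]; have := hlam j; linarith
  · rw [Fin.sum_univ_succ, Fin.sum_univ_succ]
    simp only [mu, Fin.cons_zero, Fin.cons_succ]
    have := hnusum (fun _ => 1)
    simp only [mul_one] at this
    rw [this, hsum]
    linear_combination ε * hs0
  · rw [hdiff, g1]; ring
  · rw [hdiff, g2]; ring
  · rw [hder]
    intro h
    exact mul_ne_zero hεL d1 (by linarith)
  · rw [hder]
    intro h
    exact mul_ne_zero hεL d2 (by linarith)
  · intro q h1 h2 h3 h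
    rw [hdiff] at h
    exact mul_ne_zero hεL (hne q h1 h2 h3) (by linarith)
end

section
/- Let p₁,…,p_n ∈ (0,1) and let τ = ∑_{i=1}^n λ_i·τ(p_i,·) be any convex combination (λ_i ≥ 0, ∑λ_i = 1) of the functions τ(p_i,·). Then there exists a sequence (p'_k)_{k≥1} taking values in {p₁,…,p_n} such that the inhomogeneous Bernoulli product with weights (p'_k) has L^q-spectrum equal to τ; that is, for every q ∈ ℝ, limsup_{m→∞} (1/m) ∑_{k=1}^m log₂((p'_k)^q + (1−p'_k)^q) = ∑_{i=1}^n λ_i·τ(p_i,q) (with the limsup actually a limit). -/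
open MeasureTheory Filter Set
open scoped Topology ENNReal NNReal Classical

/-- **Lemma 4.4.** For any convex combination `τ = ∑ λᵢ τ(pᵢ,·)` there is an
inhomogeneous Bernoulli product, with weights taken among `p₁, …, p_n`, whose
`L^q`-spectrum is `τ` (the defining `limsup` being a genuine limit). -/
theorem stmt18 (n : ℕ) (hn : 1 ≤ n) (p : Fin n → ℝ)
    (hp : ∀ i, p i ∈ Set.Ioo (0:ℝ) 1)
    (lam : Fin n → ℝ) (hlam : ∀ i, 0 ≤ lam i) (hsum : ∑ i, lam i = 1) :
    ∃ p' : ℕ → ℝ, (∀ k, ∃ i, p' k = p i) ∧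
      ∀ q : ℝ,
        Filter.Tendsto (fun m => tauN p' m q) Filter.atTop
          (nhds (∑ i, lam i * tauP (p i) q)) ∧
        tauLq p' q = ∑ i, lam i * tauP (p i) q := by
  classical
  have hc : ∀ v : Fin n → ℝ, ∃ i, (∑ j, v j = 0 → 0 ≤ v i + lam i) := by
    intro v
    by_contra! h
    have h0 : ∑ j, v j = 0 := (h ⟨0, hn⟩).1
    have h1 : ∑ j, (v j + lam j) ≤ 0 := Finset.sum_nonpos fun j _ => (h j).2.le
    rw [Finset.sum_add_distrib, h0, hsum] at h1
    linarith
  choose c hc using hc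
  let d : ℕ → Fin n → ℝ := fun m =>
    Nat.rec (fun _ => 0) (fun _ v i => v i + lam i - if i = c v then 1 else 0) m
  have d0 : ∀ i, d 0 i = 0 := fun i => rfl
  have dS : ∀ m i, d (m+1) i = d m i + lam i - if i = c (d m) then 1 else 0 :=
    fun m i => rfl
  have dsum : ∀ m, ∑ i, d m i = 0 := by
    intro m
    induction m with
    | zero => simp [d0]
    | succ m ih =>
      simp only [dS, Finset.sum_sub_distrib, Finset.sum_add_distrib, ih, hsum]
      simp
  have dlow : ∀ m i, -1 ≤ d m i := by
    intro m
    induction m with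
    | zero => intro i; simp [d0]
    | succ m ih =>
      intro i
      rw [dS]
      by_cases h : i = c (d m)
      · have := hc (d m) (dsum m)
        rw [← h] at this
        rw [if_pos h]; linarith
      · rw [if_neg h]
        linarith [ih i, hlam i]
  have dabs : ∀ m i, |d m i| ≤ n := by
    intro m i
    have hn' : (1:ℝ) ≤ n := by exact_mod_cast hn
    have h1 : d m i + 1 ≤ ∑ j, (d m j + 1) :=
      Finset.single_le_sum (f := fun j => d m j + 1)
        (fun j _ => by linarith [dlow m j]) (Finset.mem_univ i)
    rw [Finset.sum_add_distrib, dsum] at h1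
    simp at h1
    rw [abs_le]
    constructor <;> linarith [dlow m i]
  refine ⟨fun k => p (c (d k)), fun k => ⟨_, rfl⟩, fun q => ?_⟩
  have key : ∀ m : ℕ, ∑ k ∈ Finset.range m, tauP (p (c (d k))) q
      = m * ∑ i, lam i * tauP (p i) q - ∑ i, d m i * tauP (p i) q := by
    intro m
    induction m with
    | zero => simp [d0]
    | succ m ih =>
      rw [Finset.sum_range_succ, ih]
      simp only [dS, sub_mul, add_mul, Finset.sum_sub_distrib, Finset.sum_add_distrib]
      simp
      ring
  have hT : Filter.Tendsto (fun m => tauN (fun k => p (c (d k))) m q) Filter.atTop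
      (nhds (∑ i, lam i * tauP (p i) q)) := by
    have hb : Filter.Tendsto (fun m : ℕ => (n * ∑ i, |tauP (p i) q|) / (m:ℝ)) Filter.atTop
        (nhds 0) := tendsto_const_div_atTop_nhds_zero_nat _
    rw [tendsto_iff_dist_tendsto_zero]
    refine squeeze_zero' (Filter.Eventually.of_forall fun _ => dist_nonneg) ?_ hb
    filter_upwards [Filter.eventually_gt_atTop 0] with m hm
    have hm' : (0:ℝ) < m := by exact_mod_cast hm
    have e : tauN (fun k => p (c (d k))) m q - ∑ i, lam i * tauP (p i) q
        = -(∑ i, d m i * tauP (p i) q) / m := by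
      unfold tauN
      rw [key]
      field_simp
      ring
    rw [Real.dist_eq, e, abs_div, abs_neg, abs_of_pos hm']
    gcongr
    refine (Finset.abs_sum_le_sum_abs _ _).trans ?_
    rw [Finset.mul_sum]
    refine Finset.sum_le_sum fun i _ => ?_
    rw [abs_mul]
    exact mul_le_mul_of_nonneg_right (dabs m i) (abs_nonneg _)
  exact ⟨hT, hT.limsup_eq⟩
end

section
/- Let (a_k)_{k≥1} and (b_k)_{k≥1} be sequences taking values in a finite subset of (0,1), and suppose that for every q ∈ ℝ the Cesàro averages A_n(q) = (1/n)∑_{k=1}^n log₂(a_k^q + (1−a_k)^q) and B_n(q) = (1/n)∑_{k=1}^n log₂(b_k^q + (1−b_k)^q) converge to limits A(q) and B(q) respectively. Let (ℓ_k)_{k≥1} be an increasing sequence of integers with ℓ_{k+1}/(ℓ_1 + … + ℓ_k) → ∞ and set L_0 = 0, L_k = ℓ_1 + … + ℓ_k. Define the interleaved sequence (p_i) by p_i = a_i if L_{2k} < i ≤ L_{2k+1} for some k ≥ 0, and p_i = b_i if L_{2k+1} < i ≤ L_{2k+2} for some k ≥ 0. Then the inhomogeneous Bernoulli product with weights (p_i)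 has L^q-spectrum τ(q) = limsup_{n→∞} (1/n)∑_{k=1}^n log₂(p_k^q + (1−p_k)^q) = max( A(q), B(q) ) for every q ∈ ℝ. -/
open MeasureTheory Filter Set
open scoped Topology ENNReal NNReal Classical

lemma blk_exists (L : ℕ → ℕ) (hmono : Monotone L) (hL0 : L 0 = 0)
    (htop : Tendsto L atTop atTop) (K n : ℕ) (h : L K ≤ n) :
    ∃ k, K ≤ k ∧ L k ≤ n ∧ n < L (k + 1) := by
  have hex : ∃ m, n < L m := (htop.eventually_gt_atTop n).exists
  have h1 := Nat.find_spec hex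
  have h2 := fun m => Nat.find_min hex (m := m)
  generalize Nat.find hex = m at h1 h2
  have hK : K < m := by
    by_contra hc
    have := hmono (not_lt.mp hc)
    omega
  obtain ⟨k, rfl⟩ : ∃ k, m = k + 1 := ⟨m - 1, by omega⟩
  exact ⟨k, by omega, not_lt.mp (h2 k (by omega)), h1⟩

lemma blk_sum (f g : ℕ → ℝ) (u v n : ℕ) (h : ∀ i, u ≤ i → i < v → f i = g i)
    (h1 : u ≤ n) (h2 : n ≤ v) :
    ∑ i ∈ Finset.range n, f i = ∑ i ∈ Finset.range u, f i +
      (∑ i ∈ Finset.range n, g i - ∑ i ∈ Finset.range u, g i) := by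
  have e : ∑ i ∈ Finset.Ico u n, f i = ∑ i ∈ Finset.Ico u n, g i := by
    apply Finset.sum_congr rfl
    intro i hi
    rw [Finset.mem_Ico] at hi
    exact h i hi.1 (by omega)
  rw [Finset.sum_Ico_eq_sub _ h1, Finset.sum_Ico_eq_sub _ h1] at e
  linarith

lemma sum_bd (f : ℕ → ℝ) (C : ℝ) (h : ∀ i, |f i| ≤ C) (n : ℕ) :
    |∑ i ∈ Finset.range n, f i| ≤ C * n := by
  calc _ ≤ ∑ i ∈ Finset.range n, |f i| := Finset.abs_sum_le_sum_abs _ _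
    _ ≤ ∑ i ∈ Finset.range n, C := Finset.sum_le_sum fun i _ => h i
    _ = C * n := by simp [mul_comm]

lemma core1 (f : ℕ → ℝ) (g : ℕ → ℕ → ℝ) (G : ℕ → ℝ) (C : ℝ) (hC : 0 < C)
    (hf : ∀ i, |f i| ≤ C) (hg : ∀ k i, |g k i| ≤ C)
    (L : ℕ → ℕ) (hmono : Monotone L) (htop : Tendsto L atTop atTop)
    (hr : ∀ ε > (0:ℝ), ∀ᶠ k in atTop, (L k : ℝ) ≤ ε * L (k + 1))
    (hfg : ∀ k i, L k ≤ i → i < L (k + 1) → f i = g k i)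
    (hG : ∀ ε > (0:ℝ), ∀ᶠ n : ℕ in atTop, ∀ k,
      |∑ i ∈ Finset.range n, g k i - G k * n| ≤ ε * n) :
    ∀ ε > (0:ℝ), ∀ᶠ k in atTop,
      |∑ i ∈ Finset.range (L (k + 1)), f i - G k * L (k + 1)| ≤ ε * L (k + 1) := by
  intro ε hε
  have t1 : Tendsto (fun k => L (k + 1)) atTop atTop := htop.comp (tendsto_add_atTop_nat 1)
  filter_upwards [hr (ε / (4 * C)) (by positivity), t1.eventually (hG (ε / 2) (by positivity))]
    with k h1 h2
  rw [blk_sum f (g k) (L k) (L (k+1)) (L (k+1)) (hfg k) (hmono (Nat.le_succ k)) le_rfl]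
  have h3 := sum_bd f C hf (L k)
  have h4 := sum_bd (g k) C (hg k) (L k)
  have h5 := h2 k
  have h6 : C * L k ≤ ε / 4 * L (k + 1) := by
    calc C * L k ≤ C * (ε / (4 * C) * L (k + 1)) := by gcongr
      _ = _ := by field_simp
  rw [abs_le] at *
  constructor <;> linarith

lemma core2 (f : ℕ → ℝ) (g : ℕ → ℕ → ℝ) (G : ℕ → ℝ) (M : ℝ) (hM : ∀ k, G k ≤ M)
    (L : ℕ → ℕ) (hmono : Monotone L) (hL0 : L 0 = 0) (htop : Tendsto L atTop atTop)
    (hfg : ∀ k i, L k ≤ i → i < L (k + 1) → f i = g k i)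
    (hG : ∀ ε > (0:ℝ), ∀ᶠ n : ℕ in atTop, ∀ k,
      |∑ i ∈ Finset.range n, g k i - G k * n| ≤ ε * n)
    (h1 : ∀ ε > (0:ℝ), ∀ᶠ k in atTop,
      |∑ i ∈ Finset.range (L (k + 1)), f i - G k * L (k + 1)| ≤ ε * L (k + 1)) :
    ∀ ε > (0:ℝ), ∀ᶠ n : ℕ in atTop, ∑ i ∈ Finset.range n, f i ≤ (M + ε) * n := by
  intro ε hε
  obtain ⟨K, hK⟩ := eventually_atTop.1 (h1 (ε / 3) (by positivity))
  obtain ⟨N, hN⟩ := eventually_atTop.1 (hG (ε / 3) (by positivity))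
  obtain ⟨K', hK'⟩ := eventually_atTop.1 (htop.eventually_ge_atTop N)
  filter_upwards [eventually_ge_atTop (L (max (K + 1) K'))] with n hn
  obtain ⟨k, hk, hk1, hk2⟩ := blk_exists L hmono hL0 htop _ n hn
  have hkK : K + 1 ≤ k := le_trans (le_max_left _ _) hk
  have hkK' : K' ≤ k := le_trans (le_max_right _ _) hk
  rw [blk_sum f (g k) (L k) (L (k+1)) n (hfg k) hk1 hk2.le]
  obtain ⟨j, rfl⟩ : ∃ j, k = j + 1 := ⟨k - 1, by omega⟩
  have e1 := (abs_le.1 (hK j (by omega))).2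
  have e2 := (abs_le.1 (hN (L (j + 1)) (hK' _ hkK') (j + 1))).1
  have e3 := (abs_le.1 (hN n ((hK' _ hkK').trans hk1) (j + 1))).2
  have c : (L (j + 1) : ℝ) ≤ n := by exact_mod_cast hk1
  have m1 : G (j + 1) * (n - L (j + 1)) ≤ M * (n - L (j + 1)) :=
    mul_le_mul_of_nonneg_right (hM _) (by linarith)
  have m2 : G j * L (j + 1) ≤ M * L (j + 1) :=
    mul_le_mul_of_nonneg_right (hM _) (by positivity)
  have m3 : ε / 3 * L (j + 1) ≤ ε / 3 * n := by gcongr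
  nlinarith

lemma tauN_dev (a : ℕ → ℝ) (q A : ℝ) (h : Tendsto (fun n => tauN a n q) atTop (𝓝 A)) :
    ∀ ε > (0:ℝ), ∀ᶠ n : ℕ in atTop,
      |∑ i ∈ Finset.range n, tauP (a i) q - A * n| ≤ ε * n := by
  intro ε hε
  filter_upwards [Metric.tendsto_nhds.1 h ε hε, eventually_gt_atTop 0] with n hn h0
  have hn0 : (0:ℝ) < n := by exact_mod_cast h0
  rw [Real.dist_eq, tauN] at hn
  have : ∑ i ∈ Finset.range n, tauP (a i) q - A * n
      = (1 / n * ∑ i ∈ Finset.range n, tauP (a i) q - A) * n := by field_simp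
  rw [this, abs_mul, abs_of_pos hn0]
  gcongr

/-- Interleaving two weight sequences `a`, `b` (taking finitely many values in `(0,1)`,
with convergent Cesàro averages `A(q)`, `B(q)`) along blocks `(L_k, L_{k+1}]` of lengths
`ℓ_k` with `ℓ_{k+1}/(ℓ_1 + … + ℓ_k) → ∞` yields an inhomogeneous Bernoulli product with
`L^q`-spectrum `τ(q) = max(A(q), B(q))`. -/
theorem stmt19 (S : Finset ℝ) (hS : ∀ x ∈ S, x ∈ Set.Ioo (0:ℝ) 1)
    (a b : ℕ → ℝ) (ha : ∀ k, a k ∈ S) (hb : ∀ k, b k ∈ S)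
    (A B : ℝ → ℝ)
    (hA : ∀ q : ℝ, Filter.Tendsto (fun n => tauN a n q) Filter.atTop (nhds (A q)))
    (hB : ∀ q : ℝ, Filter.Tendsto (fun n => tauN b n q) Filter.atTop (nhds (B q)))
    (ℓ : ℕ → ℕ) (hℓ : StrictMono ℓ)
    (L : ℕ → ℕ) (hL0 : L 0 = 0) (hLs : ∀ k, L (k + 1) = L k + ℓ k)
    (hratio : Filter.Tendsto (fun k => (ℓ (k + 1) : ℝ) / (L (k + 1) : ℝ))
      Filter.atTop Filter.atTop)
    (p : ℕ → ℝ)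
    (hpa : ∀ k i, L (2 * k) ≤ i → i < L (2 * k + 1) → p i = a i)
    (hpb : ∀ k i, L (2 * k + 1) ≤ i → i < L (2 * k + 2) → p i = b i) :
    ∀ q : ℝ, tauLq p q = max (A q) (B q) := by
  intro q
  have hmono : Monotone L := monotone_nat_of_le_succ fun k => by rw [hLs]; omega
  have hLk : ∀ k, k ≤ L (k + 1) := fun k => by
    have := hℓ.id_le k
    simp only [id] at this
    rw [hLs]; omega
  have htop : Tendsto L atTop atTop := by
    rw [← tendsto_add_atTop_iff_nat 1]
    exact tendsto_atTop_mono hLk tendsto_id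
  have hr : ∀ ε > (0:ℝ), ∀ᶠ k in atTop, (L k : ℝ) ≤ ε * L (k + 1) := by
    intro ε hε
    have : ∀ᶠ k in atTop, (L (k + 1) : ℝ) ≤ ε * L (k + 1 + 1) := by
      filter_upwards [hratio.eventually_ge_atTop (1 / ε), eventually_gt_atTop 0] with k hk h0
      have hp : (0:ℝ) < L (k + 1) := by
        have := hLk k
        exact_mod_cast (by omega : 0 < L (k + 1))
      rw [div_le_div_iff₀ hε hp] at hk
      rw [hLs (k + 1)]
      push_cast
      nlinarith
    obtain ⟨K, hK⟩ := eventually_atTop.1 this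
    filter_upwards [eventually_ge_atTop (K + 1)] with k hk
    obtain ⟨j, rfl⟩ : ∃ j, k = j + 1 := ⟨k - 1, by omega⟩
    exact hK j (by omega)
  obtain ⟨C, hC, hCS⟩ : ∃ C : ℝ, 0 < C ∧ ∀ x ∈ S, |tauP x q| ≤ C := by
    refine ⟨∑ x ∈ S, |tauP x q| + 1, by positivity, fun x hx => ?_⟩
    have := Finset.single_le_sum (f := fun x => |tauP x q|) (fun i _ => abs_nonneg _) hx
    linarith
  set f : ℕ → ℝ := fun i => tauP (p i) q with hfdef
  set g : ℕ → ℕ → ℝ := fun k i => if Even k then tauP (a i) q else tauP (b i) q with hgdef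
  set G : ℕ → ℝ := fun k => if Even k then A q else B q with hGdef
  have hg : ∀ k i, |g k i| ≤ C := by
    intro k i
    simp only [hgdef]
    split_ifs
    · exact hCS _ (ha i)
    · exact hCS _ (hb i)
  have hfg : ∀ k i, L k ≤ i → i < L (k + 1) → f i = g k i := by
    intro k i h1 h2
    simp only [hfdef, hgdef]
    split_ifs with hk
    · obtain ⟨m, rfl⟩ := even_iff_exists_two_mul.1 hk
      rw [hpa m i h1 h2]
    · obtain ⟨m, rfl⟩ := Nat.not_even_iff_odd.1 hk
      rw [hpb m i h1 h2]
  have hf : ∀ i, |f i| ≤ C := by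
    intro i
    obtain ⟨k, -, h1, h2⟩ := blk_exists L hmono hL0 htop 0 i (by omega)
    rw [hfg k i h1 h2]
    exact hg k i
  have hG : ∀ ε > (0:ℝ), ∀ᶠ n : ℕ in atTop, ∀ k,
      |∑ i ∈ Finset.range n, g k i - G k * n| ≤ ε * n := by
    intro ε hε
    filter_upwards [tauN_dev a q _ (hA q) ε hε, tauN_dev b q _ (hB q) ε hε] with n h1 h2 k
    by_cases hk : Even k
    · simpa [hgdef, hGdef, hk] using h1
    · simpa [hgdef, hGdef, hk] using h2
  have H1 := core1 f g G C hC hf hg L hmono htop hr hfg hG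
  have hM : ∀ k, G k ≤ max (A q) (B q) := by
    intro k
    simp only [hGdef]
    split_ifs
    · exact le_max_left _ _
    · exact le_max_right _ _
  have H2 := core2 f g G _ hM L hmono hL0 htop hfg hG H1
  have hbd : ∀ n, |tauN p n q| ≤ C := by
    intro n
    have := sum_bd f C hf n
    rcases Nat.eq_zero_or_pos n with rfl | h0
    · simp [tauN, hC.le]
    · have hn0 : (0:ℝ) < n := by exact_mod_cast h0
      rw [tauN, abs_mul, abs_of_pos (by positivity), one_div, inv_mul_le_iff₀ hn0, mul_comm]
      exact this
  have hba : IsBoundedUnder (· ≤ ·) atTop (fun n => tauN p n q) :=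
    isBoundedUnder_of ⟨C, fun n => (abs_le.1 (hbd n)).2⟩
  have hbb : IsBoundedUnder (· ≥ ·) atTop (fun n => tauN p n q) :=
    isBoundedUnder_of ⟨-C, fun n => (abs_le.1 (hbd n)).1⟩
  have key : ∀ ε > (0:ℝ), ∀ᶠ k in atTop, G k - ε ≤ tauN p (L (k + 1)) q := by
    intro ε hε
    filter_upwards [H1 ε hε, eventually_gt_atTop 0] with k hk h0
    have hp : (0:ℝ) < L (k + 1) := by
      have := hLk k
      exact_mod_cast (by omega : 0 < L (k + 1))
    have h3 := (abs_le.1 hk).1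
    rw [tauN, one_div, le_inv_mul_iff₀ hp]
    simp only [hfdef] at h3
    linarith
  have low : ∀ (c : ℝ) (s : ℕ → ℕ), (∀ k, k ≤ s k) → (∀ k, G (s k) = c) → c ≤ tauLq p q := by
    intro c s hs hc
    apply le_of_forall_pos_le_add
    intro ε hε
    rw [← sub_le_iff_le_add]
    apply le_limsup_of_frequently_le _ hba
    obtain ⟨K, hK⟩ := eventually_atTop.1 (key ε hε)
    rw [frequently_atTop]
    intro N
    have hsn := hs (max N K)
    refine ⟨L (s (max N K) + 1), ?_, ?_⟩
    · exact (le_max_left N K).trans (hsn.trans (hLk _))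
    · have := hK (s (max N K)) ((le_max_right N K).trans hsn)
      rwa [hc] at this
  apply le_antisymm
  · apply le_of_forall_pos_le_add
    intro ε hε
    apply limsup_le_of_le hbb.isCoboundedUnder_le
    filter_upwards [H2 ε hε, eventually_gt_atTop 0] with n hn h0
    have hn0 : (0:ℝ) < n := by exact_mod_cast h0
    rw [tauN, one_div, inv_mul_le_iff₀ hn0, mul_comm]
    exact hn
  · apply max_le
    · exact low _ (fun k => 2 * k) (fun k => by omega) (fun k => by simp [hGdef])
    · exact low _ (fun k => 2 * k + 1) (fun k => by omega) (fun k => by simp [hGdef])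
end
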